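/- For every d ≥ 1 and every ε > 0 there exists a constant C = C(d, ε) > 0 such that for every finite metric space (P, dist) with n ≥ 2 points and doubling dimension at most d, and every real ρ ≥ 2, there exists a (1+ε)-spanner H for P with at most C·n edges, degree Δ(H) ≤ C·ρ, hop-diameter at most C·(log_ρ n + α(ρ)), and lightness Ψ(H) ≤ C·ρ·log_ρ n. -/

import Mathlib

open scoped BigOperators

namespace Stmt1

variable {P : Type} [MetricSpace P]

/-- The weight of an edge (an unordered pair of points) is the distance between its
endpoints. -/
noncomputable def edgeWeight (e : Sym2 P) : ℝ :=
  Sym2.lift ⟨fun p q => dist p q, fun p q => dist_comm p q⟩ e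

/-- The total weight `ω(H)` of a graph, given as a finite set of edges. -/
noncomputable def totalWeight (H : Finset (Sym2 P)) : ℝ :=
  ∑ e ∈ H, edgeWeight e

/-- `H` is a graph on `P`: a finite set of unordered pairs of *distinct* points. -/
def IsGraphOn (H : Finset (Sym2 P)) : Prop :=
  ∀ e ∈ H, ¬ e.IsDiag

open Classical in
/-- The degree of the point `p` in the graph `H`: the number of edges incident on `p`. -/
noncomputable def degree (H : Finset (Sym2 P)) (p : P) : ℕ :=
  (H.filter (fun e => p ∈ e)).card

/-- A `t`-spanner path with `k` edges between `p` and `q` in the graph `H`. -/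
def IsSpannerPath (H : Finset (Sym2 P)) (t : ℝ) (p q : P) (k : ℕ) : Prop :=
  ∃ x : Fin (k + 1) → P, x 0 = p ∧ x (Fin.last k) = q ∧
    (∀ i : Fin k, s(x i.castSucc, x i.succ) ∈ H) ∧
    ∑ i : Fin k, dist (x i.castSucc) (x i.succ) ≤ t * dist p q

/-- `H` is a `t`-spanner: every pair of points admits a `t`-spanner path. -/
def IsSpanner (H : Finset (Sym2 P)) (t : ℝ) : Prop :=
  ∀ p q : P, ∃ k : ℕ, IsSpannerPath H t p q k

/-- The graph `T` connects all the points of `P`. -/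
def IsConnectedOn (T : Finset (Sym2 P)) : Prop :=
  ∀ p q : P, ∃ (k : ℕ) (x : Fin (k + 1) → P), x 0 = p ∧ x (Fin.last k) = q ∧
    ∀ i : Fin k, s(x i.castSucc, x i.succ) ∈ T

/-- `ω(MST(P))`: the minimum weight of a connected graph on `P` with `|P| - 1` edges. -/
noncomputable def mstWeight (P : Type) [MetricSpace P] [Fintype P] : ℝ :=
  sInf {w : ℝ | ∃ T : Finset (Sym2 P), IsGraphOn T ∧ IsConnectedOn T ∧
    T.card = Fintype.card P - 1 ∧ totalWeight T = w}

/-- The inverse Ackermann function: the least `k ≥ 1` with `A(k,k) ≥ x`. -/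
noncomputable def invAck (x : ℝ) : ℕ :=
  sInf {k : ℕ | 1 ≤ k ∧ x ≤ ack k k}

/-- A metric space has doubling dimension at most `d` if every ball can be covered
by at most `2^d` balls of half its radius. -/
def DoublingDimLE (P : Type) [MetricSpace P] (d : ℕ) : Prop :=
  ∀ (x : P) (r : ℝ), ∃ S : Finset P, S.card ≤ 2 ^ d ∧
    Metric.ball x r ⊆ ⋃ y ∈ S, Metric.ball y (r / 2)

/-- A walk from `u` to `v` along the relation `A`, with at most `k` steps and of total cost at
most `L`. -/
inductive Reach {V : Type*} (A : V → V → Prop) (c : V → V → ℝ) : ℕ → ℝ → V → V → Prop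
  | refl {k : ℕ} {L : ℝ} {u : V} : 0 ≤ L → Reach A c k L u u
  | step {k : ℕ} {L L' : ℝ} {u w v : V} :
      A u w → Reach A c k L w v → c u w + L ≤ L' → Reach A c (k + 1) L' u v

namespace Reach

variable {V W : Type*} {A : V → V → Prop} {c : V → V → ℝ} {k k' : ℕ} {L L' : ℝ} {u v w : V}

theorem mono (h : Reach A c k L u v) (hk : k ≤ k') (hL : L ≤ L') : Reach A c k' L' u v := by
  induction h generalizing k' L' with
  | refl h0 => exact .refl (h0.trans hL)
  | step ha _ hc ih =>
    obtain ⟨j, rfl⟩ : ∃ j, k' = j + 1 := ⟨k' - 1, by omega⟩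
    exact .step ha (ih (by omega) le_rfl) (hc.trans hL)

theorem single (h : A u v) (hc : c u v ≤ L) : Reach A c 1 L u v :=
  .step (L := 0) h (.refl (k := 0) le_rfl) (by simpa using hc)

theorem trans (h : Reach A c k L u v) (h' : Reach A c k' L' v w) :
    Reach A c (k + k') (L + L') u w := by
  induction h with
  | refl h0 => exact h'.mono (by omega) (by linarith)
  | step ha _ hc ih =>
    rw [Nat.add_right_comm]
    exact .step ha (ih h') (by linarith)

theorem symm (hA : ∀ u v, A u v → A v u) (hc : ∀ u v, c u v = c v u)
    (h : Reach A c k L u v) : Reach A c k L v u := by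
  induction h with
  | refl h0 => exact .refl h0
  | step ha _ hL ih =>
    refine (ih.trans (single (hA _ _ ha) le_rfl)).mono le_rfl ?_
    rw [hc]; linarith

theorem map {A' : W → W → Prop} {c' : W → W → ℝ} {K : ℝ} (hK : 0 ≤ K) (f : V → W)
    (h : Reach A c k L u v) (hA : ∀ u v, A u v → A' (f u) (f v))
    (hc : ∀ u v, A u v → c' (f u) (f v) ≤ K * c u v) : Reach A' c' k (K * L) (f u) (f v) := by
  induction h with
  | refl h0 => exact .refl (mul_nonneg hK h0)
  | step ha _ hL ih =>
    refine .step (hA _ _ ha) ih ?_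
    nlinarith [hc _ _ ha, mul_le_mul_of_nonneg_left hL hK]

end Reach

/-- Adjacency, in either direction, in a finite set of ordered pairs. -/
def Joined {V : Type*} (E : Finset (V × V)) (u w : V) : Prop := (u, w) ∈ E ∨ (w, u) ∈ E

/-- Walks in a finite set of pairs, where a step costs the larger of the scales of its ends. -/
abbrev Climb {V : Type*} (E : Finset (V × V)) (r : V → ℝ) : ℕ → ℝ → V → V → Prop :=
  Reach (Joined E) (fun u w => max (r u) (r w))

namespace Climb

variable {V : Type*} {E E' : Finset (V × V)} {r : V → ℝ} {k : ℕ} {L : ℝ} {u v : V}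

theorem subset (h : Climb E r k L u v) (hE : E ⊆ E') : Climb E' r k L u v := by
  have := Reach.map (K := 1) (A' := Joined E') (c' := fun u w => max (r u) (r w))
    zero_le_one id h (fun u v h => h.imp (@hE _) (@hE _)) (by simp)
  simpa using this

theorem reverse (h : Climb E r k L u v) : Climb E r k L v u :=
  Reach.symm (fun _ _ h => h.symm) (fun _ _ => max_comm _ _) h

theorem up (h : (u, v) ∈ E) (hr : r u ≤ r v) : Climb E r 1 (r v) u v :=
  .single (.inl h) (by simp [hr])

theorem down (h : (v, u) ∈ E) (hr : r v ≤ r u) : Climb E r 1 (r u) u v :=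
  .single (.inr h) (by simp [hr])

end Climb

open Classical in
theorem exists_binning {V : Type*} (w : V → ℕ) (N X : ℕ) (S : Finset V)
    (hw : ∀ x ∈ S, w x < X) (hS : ∑ x ∈ S, w x < N * X) :
    ∃ f : V → ℕ, (∀ x, f x < N) ∧ ∀ i, ∑ x ∈ S with f x = i, w x < 2 * X := by
  induction S using Finset.induction_on with
  | empty =>
    have hN : 0 < N ∧ 0 < X := by
      simp only [Finset.sum_empty] at hS
      exact ⟨Nat.pos_of_mul_pos_right hS, Nat.pos_of_mul_pos_left hS⟩
    exact ⟨fun _ => 0, fun _ => hN.1, fun i => by simpa using hN.2⟩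
  | insert a S ha ih =>
    rw [Finset.sum_insert ha] at hS
    obtain ⟨f, hfN, hf⟩ := ih (fun x hx => hw x (Finset.mem_insert_of_mem hx)) (by omega)
    obtain ⟨j, hjN, hj⟩ : ∃ j < N, ∑ x ∈ S with f x = j, w x < X := by
      by_contra! h
      have h1 : ∑ x ∈ S, w x = ∑ j ∈ Finset.range N, ∑ x ∈ S with f x = j, w x :=
        (Finset.sum_fiberwise_of_maps_to (fun x _ => Finset.mem_range.2 (hfN x)) _).symm
      have h2 : ∑ j ∈ Finset.range N, X ≤ ∑ j ∈ Finset.range N, ∑ x ∈ S with f x = j, w x :=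
        Finset.sum_le_sum fun j hj => h j (Finset.mem_range.1 hj)
      simp only [Finset.sum_const, Finset.card_range, smul_eq_mul] at h2
      omega
    refine ⟨Function.update f a j, fun x => ?_, fun i => ?_⟩
    · by_cases hx : x = a
      · simpa [hx] using hjN
      · simpa [hx] using hfN x
    · have hS' : S.filter (fun x => Function.update f a j x = i) = S.filter (fun x => f x = i) := by
        refine Finset.filter_congr fun x hx => ?_
        rw [Function.update_of_ne (by rintro rfl; exact ha hx)]
      rw [Finset.filter_insert, Function.update_self, hS']
      split_ifs with hij
      · subst hij
        rw [Finset.sum_insert (fun h => ha (Finset.mem_of_mem_filter _ h))]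
        have := hw a (Finset.mem_insert_self _ _)
        omega
      · exact hf i

theorem exists_least_of_chain {V : Type*} [PartialOrder V] {S : Finset V} (hne : S.Nonempty)
    (hS : ∀ x ∈ S, ∀ y ∈ S, x ≤ y ∨ y ≤ x) : ∃ z ∈ S, ∀ x ∈ S, z ≤ x := by
  obtain ⟨z, hz⟩ := S.exists_minimal hne
  refine ⟨z, hz.1, fun x hx => ?_⟩
  rcases hS z hz.1 x hx with h | h
  · exact h
  · exact hz.2 hx h

open Classical in
/-- A weighted heap on a chain: heavy elements are close to the least element, and parents are
smaller than their children. -/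
theorem exists_heap {V : Type*} [PartialOrder V] (r : V → ℝ) (w : V → ℕ) {b : ℕ} (hb : 2 ≤ b)
    (T : ℕ) (S : Finset V) (hS : ∀ x ∈ S, ∀ y ∈ S, x ≤ y ∨ y ≤ x)
    (hr : ∀ x ∈ S, ∀ y ∈ S, x < y → 2 * r x ≤ r y) (hr0 : ∀ x, 0 ≤ r x)
    (hw : ∀ x ∈ S, 1 ≤ w x) (hsum : ∑ x ∈ S, w x < 2 * b ^ T)
    (z : V) (hz : z ∈ S) (hzmin : ∀ x ∈ S, z ≤ x) :
    ∃ E : Finset (V × V), (∀ e ∈ E, e.1 ∈ S ∧ e.2 ∈ S ∧ e.1 < e.2) ∧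
      (∀ v, (E.filter (fun e => e.2 = v)).card ≤ 1) ∧
      (∀ v, (E.filter (fun e => e.1 = v)).card ≤ 4 * b) ∧
      ∀ x ∈ S, ∀ l, b ^ l ≤ w x →
        ∃ k, k + l ≤ T + 1 ∧ Climb E r k (2 * (r x - r z)) x z := by
  induction T generalizing S z with
  | zero =>
    rw [pow_zero] at hsum
    have hx : ∀ x ∈ S, x = z := by
      intro x hx
      by_contra hne
      have h1 : ∑ y ∈ ({x, z} : Finset V), w y ≤ ∑ y ∈ S, w y :=
        Finset.sum_le_sum_of_subset (by simp [Finset.insert_subset_iff, hx, hz])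
      rw [Finset.sum_pair hne] at h1
      have := hw x hx
      have := hw z hz
      omega
    refine ⟨∅, by simp, by simp, by simp, fun x hxS l hl => ⟨0, ?_, ?_⟩⟩
    · have h1 : w x < 2 := by
        have := Finset.single_le_sum (f := w) (fun _ _ => Nat.zero_le _) hxS
        omega
      have : l < 2 ^ l := Nat.lt_two_pow_self
      have := Nat.pow_le_pow_left hb l
      omega
    · rw [hx x hxS]; exact .refl (by simp)
  | succ T ih =>
    set X := b ^ T with hX
    have hlbound : ∀ x ∈ S, ∀ l, b ^ l ≤ w x → l ≤ T + 1 := by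
      intro x hx l hl
      by_contra! h
      have h1 := Finset.single_le_sum (f := w) (fun _ _ => Nat.zero_le _) hx
      have h2 : b ^ (T + 2) ≤ b ^ l := Nat.pow_le_pow_right (by omega) h
      have h3 : 2 * b ^ (T + 1) ≤ b ^ (T + 2) := by
        rw [pow_succ b (T + 1), mul_comm]; exact Nat.mul_le_mul_left _ hb
      omega
    set S' := S.erase z with hS'
    have hsub : S' ⊆ S := Finset.erase_subset _ _
    have hsum' : ∑ x ∈ S', w x < 2 * b * X := by
      refine (Finset.sum_le_sum_of_subset hsub).trans_lt (hsum.trans_le ?_)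
      rw [pow_succ]; ring_nf; rfl
    obtain ⟨f, hfN, hf⟩ := exists_binning w (2 * b) X (S'.filter (fun x => w x < X))
      (fun x hx => (Finset.mem_filter.1 hx).2)
      ((Finset.sum_le_sum_of_subset (Finset.filter_subset _ _)).trans_lt hsum')
    set key : V → V ⊕ ℕ := fun x => if w x < X then .inr (f x) else .inl x with hkey
    set I := S'.image key with hI
    have hIcard : I.card ≤ 4 * b := by
      have h1 : I ⊆ (S'.filter (fun x => ¬ w x < X)).image Sum.inl ∪
          (Finset.range (2 * b)).image Sum.inr := by
        intro i hi
        obtain ⟨x, hx, rfl⟩ := Finset.mem_image.1 hi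
        by_cases hwx : w x < X
        · simp [hkey, hwx, hfN]
        · simp only [hkey, hwx, if_false, Finset.mem_union, Finset.mem_image, Finset.mem_filter]
          exact .inl ⟨x, ⟨hx, hwx⟩, rfl⟩
      have h2 : (S'.filter (fun x => ¬ w x < X)).card ≤ 2 * b := by
        have h3 : (S'.filter (fun x => ¬ w x < X)).card * X ≤ ∑ x ∈ S', w x := by
          refine le_trans ?_ (Finset.sum_le_sum_of_subset
            (Finset.filter_subset (fun x => ¬ w x < X) _))
          rw [← smul_eq_mul]
          exact Finset.card_nsmul_le_sum _ _ _ fun x hx => not_lt.1 (Finset.mem_filter.1 hx).2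
        exact (Nat.lt_of_mul_lt_mul_right (h3.trans_lt hsum')).le
      calc I.card ≤ _ := Finset.card_le_card h1
        _ ≤ _ := Finset.card_union_le _ _
        _ ≤ 2 * b + 2 * b := add_le_add (Finset.card_image_le.trans h2)
            (Finset.card_image_le.trans (by simp))
        _ = 4 * b := by ring
    have hgroup : ∀ i ∈ I, ∃ y ∈ S', key y = i ∧ ∃ E : Finset (V × V),
        (∀ e ∈ E, (e.1 ∈ S' ∧ key e.1 = i) ∧ (e.2 ∈ S' ∧ key e.2 = i) ∧ e.1 < e.2) ∧
        (∀ v, (E.filter (fun e => e.2 = v)).card ≤ 1) ∧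
        (∀ e ∈ E, e.2 ≠ y) ∧
        (∀ v, (E.filter (fun e => e.1 = v)).card ≤ 4 * b) ∧
        ∀ x ∈ S', key x = i → ∀ l, b ^ l ≤ w x →
          ∃ k, k + l ≤ T + 1 ∧ Climb E r k (2 * (r x - r y)) x y := by
      intro i hi
      obtain ⟨x, hx, hxi⟩ := Finset.mem_image.1 hi
      by_cases hwx : w x < X
      · set G := S'.filter (fun x => key x = i) with hG
        have hGS : G ⊆ S := (Finset.filter_subset _ _).trans hsub
        obtain ⟨y, hy, hymin⟩ := exists_least_of_chain (S := G)
          ⟨x, Finset.mem_filter.2 ⟨hx, hxi⟩⟩ fun u hu v hv => hS u (hGS hu) v (hGS hv)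
        have hGsum : ∑ x ∈ G, w x < 2 * X := by
          convert hf (f x) using 2
          ext v
          simp only [hG, Finset.mem_filter, and_assoc]
          refine and_congr_right fun _ => ?_
          rw [← hxi]
          simp only [hkey, hwx, if_true]
          by_cases hv : w v < X <;> simp [hv]
        obtain ⟨E, h1, h2, h3, h4⟩ := ih G (fun u hu v hv => hS u (hGS hu) v (hGS hv))
          (fun u hu v hv => hr u (hGS hu) v (hGS hv)) (fun u hu => hw u (hGS hu)) hGsum y hy hymin
        refine ⟨y, (Finset.mem_filter.1 hy).1, (Finset.mem_filter.1 hy).2, E, ?_, h2, ?_, h3, ?_⟩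
        · intro e he
          obtain ⟨h5, h6, h7⟩ := h1 e he
          exact ⟨Finset.mem_filter.1 h5, Finset.mem_filter.1 h6, h7⟩
        · rintro e he rfl
          obtain ⟨h5, h6, h7⟩ := h1 e he
          exact absurd (hymin _ h5) (not_le_of_gt h7)
        · intro u hu hui
          exact h4 u (Finset.mem_filter.2 ⟨hu, hui⟩)
      · refine ⟨x, hx, hxi, ∅, by simp, by simp, by simp, by simp, ?_⟩
        intro u hu hui l hl
        have hux : u = x := by
          rw [← hui] at hxi
          by_cases hwu : w u < X
          · simp [hkey, hwx, hwu] at hxi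
          · simpa [hkey, hwx, hwu, eq_comm] using hxi
        subst hux
        refine ⟨0, ?_, .refl (by simp)⟩
        have := hlbound u (hsub hu) l hl
        omega
    have : Nonempty V := ⟨z⟩
    choose! y hyS hyk E hE1 hE2 hE2' hE3 hE4 using hgroup
    have hzy : ∀ x ∈ S', z < x := fun x hx =>
      lt_of_le_of_ne (hzmin x (hsub hx)) (Ne.symm (Finset.mem_erase.1 hx).1)
    refine ⟨I.biUnion E ∪ I.image (fun i => (z, y i)), ?_, ?_, ?_, ?_⟩
    · intro e he
      simp only [Finset.mem_union, Finset.mem_biUnion, Finset.mem_image] at he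
      rcases he with ⟨i, hi, he⟩ | ⟨i, hi, rfl⟩
      · obtain ⟨h1, h2, h3⟩ := hE1 i hi e he
        exact ⟨hsub h1.1, hsub h2.1, h3⟩
      · exact ⟨hz, hsub (hyS i hi), hzy _ (hyS i hi)⟩
    · intro v
      rw [Finset.card_le_one]
      intro e he e' he'
      simp only [Finset.mem_filter, Finset.mem_union, Finset.mem_biUnion, Finset.mem_image]
        at he he'
      obtain ⟨he, hev⟩ := he
      obtain ⟨he', rfl⟩ := he'
      rcases he with ⟨i, hi, he⟩ | ⟨i, hi, rfl⟩ <;> rcases he' with ⟨j, hj, he'⟩ | ⟨j, hj, rfl⟩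
      · obtain rfl : i = j := by
          rw [← (hE1 i hi e he).2.1.2, ← (hE1 j hj e' he').2.1.2, hev]
        exact Finset.card_le_one.1 (hE2 i hi e'.2) e (Finset.mem_filter.2 ⟨he, hev⟩) e'
          (Finset.mem_filter.2 ⟨he', rfl⟩)
      · obtain rfl : i = j := by
          rw [← (hE1 i hi e he).2.1.2, hev]; exact hyk j hj
        exact absurd hev (hE2' i hi e he)
      · obtain rfl : i = j := by
          rw [← (hE1 j hj e' he').2.1.2, ← hev]; exact (hyk i hi).symm
        exact absurd hev.symm (hE2' i hi e' he')
      · obtain rfl : i = j := by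
          rw [← hyk i hi, ← hyk j hj]; exact congrArg key hev
        rfl
    · intro v
      by_cases hvz : v = z
      · subst hvz
        refine (Finset.card_le_card (t := I.image (fun i => (v, y i))) ?_).trans
          (Finset.card_image_le.trans hIcard)
        intro e he
        simp only [Finset.mem_filter, Finset.mem_union, Finset.mem_biUnion] at he
        rcases he with ⟨⟨i, hi, he⟩ | he, hev⟩
        · exact absurd hev (hzy _ (hE1 i hi e he).1.1).ne'
        · exact he
      · by_cases hvI : key v ∈ I
        · refine (Finset.card_le_card ?_).trans (hE3 (key v) hvI v)
          intro e he
          simp only [Finset.mem_filter, Finset.mem_union, Finset.mem_biUnion,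
            Finset.mem_image] at he
          rcases he with ⟨⟨i, hi, he⟩ | ⟨i, hi, rfl⟩, hev⟩
          · obtain rfl : i = key v := by rw [← (hE1 i hi e he).1.2, hev]
            exact Finset.mem_filter.2 ⟨he, hev⟩
          · exact absurd hev.symm hvz
        · rw [Finset.card_eq_zero.2]
          · exact Nat.zero_le _
          rw [Finset.filter_eq_empty_iff]
          intro e he hev
          simp only [Finset.mem_union, Finset.mem_biUnion, Finset.mem_image] at he
          rcases he with ⟨i, hi, he⟩ | ⟨i, hi, rfl⟩
          · exact hvI (by rwa [← hev, (hE1 i hi e he).1.2])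
          · exact hvz hev.symm
    · intro x hx l hl
      by_cases hxz : x = z
      · subst hxz
        exact ⟨0, by have := hlbound x hx l hl; omega, .refl (by simp)⟩
      have hx' : x ∈ S' := Finset.mem_erase.2 ⟨hxz, hx⟩
      have hi : key x ∈ I := Finset.mem_image_of_mem _ hx'
      obtain ⟨k, hk, hc⟩ := hE4 (key x) hi x hx' rfl l hl
      refine ⟨k + 1, by omega, ?_⟩
      have hstep : Climb (I.biUnion E ∪ I.image (fun i => (z, y i))) r 1 (r (y (key x)))
          (y (key x)) z := by
        refine Climb.down ?_ ?_
        · exact Finset.mem_union_right _ (Finset.mem_image_of_mem (fun i => (z, y i)) hi)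
        · have := hr z hz _ (hsub (hyS _ hi)) (hzy _ (hyS _ hi))
          linarith [hr0 z]
      have hc' := (hc.subset (E' := I.biUnion E ∪ I.image (fun i => (z, y i)))
        ((Finset.subset_biUnion_of_mem E hi).trans Finset.subset_union_left)).trans hstep
      refine hc'.mono le_rfl ?_
      have := hr z hz _ (hsub (hyS _ hi)) (hzy _ (hyS _ hi))
      linarith

/-- Any two members are nested or disjoint. -/
def Laminar {α : Type*} (F : Finset (Finset α)) : Prop :=
  ∀ u ∈ F, ∀ v ∈ F, u ⊆ v ∨ v ⊆ u ∨ Disjoint u v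

theorem Laminar.exists_representatives {α : Type*} [Nonempty α] {F : Finset (Finset α)}
    (hF : Laminar F) : ∃ f : Finset α → α, (∀ v ∈ F, 2 ≤ v.card → f v ∈ v) ∧
      ∀ v ∈ F, ∀ w ∈ F, 2 ≤ v.card → 2 ≤ w.card → f v = f w → v = w := by
  classical
  let _ : LinearOrder α := linearOrderOfSTO (WellOrderingRel (α := α))
  have key : ∀ v, v ∈ F ∧ 2 ≤ v.card → ∃ (q m : α) (c : Finset α), m ∈ v ∧ (∀ x ∈ v, m ≤ x) ∧
      m ∈ c ∧ (∀ c' ∈ F, c' ⊂ v → m ∈ c' → c' ⊆ c) ∧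
      (∀ u ∈ F, u ⊆ c ∨ m ∈ u ∨ Disjoint u c) ∧ q ∈ v ∧ q ∉ c ∧
      ∀ x ∈ v, x ∉ c → q ≤ x := by
    rintro v ⟨hv, hcard⟩
    have hne : v.Nonempty := Finset.card_pos.1 (by omega)
    set m := v.min' hne with hm
    have hmv : m ∈ v := v.min'_mem hne
    obtain ⟨c, hc, hmax⟩ := Finset.exists_max_image
      (insert {m} (F.filter (fun c => c ⊂ v ∧ m ∈ c))) Finset.card ⟨{m}, by simp⟩
    have hcv : c ⊂ v ∧ m ∈ c := by
      rcases Finset.mem_insert.1 hc with rfl | hc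
      · refine ⟨Finset.ssubset_iff_subset_ne.2 ⟨by simpa using hmv, ?_⟩, by simp⟩
        rintro h
        rw [← h] at hcard
        simp at hcard
      · exact (Finset.mem_filter.1 hc).2
    have hcF : c = {m} ∨ c ∈ F := by
      rcases Finset.mem_insert.1 hc with rfl | hc
      · exact .inl rfl
      · exact .inr (Finset.mem_filter.1 hc).1
    have hne' : (v \ c).Nonempty := Finset.sdiff_nonempty.2 hcv.1.2
    have hq := Finset.mem_sdiff.1 ((v \ c).min'_mem hne')
    refine ⟨(v \ c).min' hne', m, c, hmv, fun x hx => v.min'_le x hx, hcv.2, ?_, ?_, hq.1, hq.2,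
      fun x hx hxc => (v \ c).min'_le x (Finset.mem_sdiff.2 ⟨hx, hxc⟩)⟩
    · intro c' hc' hcv' hmc'
      have hle := hmax c' (by simp [hc', hcv', hmc'])
      rcases hcF with rfl | hcF
      · rw [Finset.eq_of_subset_of_card_le (by simpa using hmc') hle]
      · rcases hF c' hc' c hcF with h | h | h
        · exact h
        · exact (Finset.eq_of_subset_of_card_le h hle).ge
        · exact absurd hcv.2 (Finset.disjoint_left.1 h hmc')
    · intro u hu
      rcases hcF with rfl | hcF
      · by_cases h : m ∈ u
        · exact .inr (.inl h)
        · exact .inr (.inr (by simpa using h))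
      · rcases hF u hu c hcF with h | h | h
        · exact .inl h
        · exact .inr (.inl (h hcv.2))
        · exact .inr (.inr h)
  choose! q m c hm hmin hmc hc hdis hq hqc hqmin using key
  have main : ∀ v ∈ F, ∀ w ∈ F, 2 ≤ v.card → 2 ≤ w.card → q v = q w → v ⊆ w → v = w := by
    intro v hv w hw hv2 hw2 hqq hvw
    by_contra hne
    have hss : v ⊂ w := Finset.ssubset_iff_subset_ne.2 ⟨hvw, hne⟩
    have hqv := hq v ⟨hv, hv2⟩
    have hqcw := hqc w ⟨hw, hw2⟩
    rw [← hqq] at hqcw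
    have hmw : m w ∉ v := fun h => hqcw (hc w ⟨hw, hw2⟩ v hv hss h hqv)
    rcases hdis w ⟨hw, hw2⟩ v hv with h | h | h
    · exact hqcw (h hqv)
    · exact hmw h
    · have h1 := hm v ⟨hv, hv2⟩
      have h2 := hqmin w ⟨hw, hw2⟩ _ (hvw h1) (Finset.disjoint_left.1 h h1)
      rw [← hqq] at h2
      have h3 := le_antisymm h2 (hmin v ⟨hv, hv2⟩ _ hqv)
      exact hqc v ⟨hv, hv2⟩ (h3 ▸ hmc v ⟨hv, hv2⟩)
  refine ⟨q, fun v hv h => hq v ⟨hv, h⟩, fun v hv w hw hv2 hw2 hqq => ?_⟩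
  rcases hF v hv w hw with h | h | h
  · exact main v hv w hw hv2 hw2 hqq h
  · exact (main w hw v hv hw2 hv2 hqq.symm h).symm
  · exact absurd (hqq ▸ hq w ⟨hw, hw2⟩) (Finset.disjoint_left.1 h (hq v ⟨hv, hv2⟩))

theorem Laminar.card_le {α : Type*} {F : Finset (Finset α)} (hF : Laminar F) {X : Finset α}
    (hne : ∀ v ∈ F, v.Nonempty) (hX : ∀ v ∈ F, v ⊆ X) : F.card ≤ 2 * X.card := by
  classical
  rcases isEmpty_or_nonempty α with hα | hα
  · rw [Finset.card_eq_zero.2]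
    · exact Nat.zero_le _
    · rw [Finset.eq_empty_iff_forall_notMem]
      intro v hv
      obtain ⟨x, -⟩ := hne v hv
      exact hα.elim x
  obtain ⟨f, hf, hinj⟩ := hF.exists_representatives
  have h1 : (F.filter (fun v => 2 ≤ v.card)).card ≤ X.card := by
    refine Finset.card_le_card_of_injOn f ?_ ?_
    · intro v hv
      have hv := Finset.mem_filter.1 hv
      exact hX v hv.1 (hf v hv.1 hv.2)
    · intro v hv w hw h
      have hv := Finset.mem_filter.1 hv
      have hw := Finset.mem_filter.1 hw
      exact hinj v hv.1 w hw.1 hv.2 hw.2 h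
  have h2 : (F.filter (fun v => ¬ 2 ≤ v.card)).card ≤ X.card := by
    refine (Finset.card_le_card (t := X.image (fun x => {x})) ?_).trans Finset.card_image_le
    intro v hv
    have hv := Finset.mem_filter.1 hv
    have h1 : v.card = 1 := by
      have := Finset.card_pos.2 (hne v hv.1)
      omega
    obtain ⟨x, rfl⟩ := Finset.card_eq_one.1 h1
    exact Finset.mem_image.2 ⟨x, hX _ hv.1 (Finset.mem_singleton_self x), rfl⟩
  rw [← Finset.card_filter_add_card_filter_not (s := F) (fun v => 2 ≤ v.card)]
  omega

/-- Comparability of any two elements of `S` above a common element of `S`. -/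
def ForestOn {V : Type*} [PartialOrder V] (S : Finset V) : Prop :=
  ∀ x ∈ S, ∀ y ∈ S, ∀ z ∈ S, x ≤ y → x ≤ z → y ≤ z ∨ z ≤ y

open Classical in
/-- Contraction of a forest to few elements: `β` sends each element to the bottom of its
branch-free segment. -/
theorem exists_contraction {V : Type*} [PartialOrder V] {S : Finset V} (hS : ForestOn S) :
    ∃ β : V → V, (∀ v ∈ S, β v ∈ S ∧ β v ≤ v) ∧ (∀ v ∈ S, β (β v) = β v) ∧
      (∀ u ∈ S, ∀ v ∈ S, u ≤ v → β u = β v ∨ u < β v) ∧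
      (S.image β).card ≤ 2 * (S.filter (fun m => ∀ x ∈ S, x ≤ m → x = m)).card := by
  set M := S.filter (fun m => ∀ x ∈ S, x ≤ m → x = m) with hM
  set μ : V → Finset V := fun v => M.filter (fun m => m ≤ v) with hμ
  have hμne : ∀ v ∈ S, (μ v).Nonempty := by
    intro v hv
    obtain ⟨m, hm⟩ := (S.filter (fun x => x ≤ v)).exists_minimal ⟨v, by simp [hv]⟩
    have h1 := Finset.mem_filter.1 hm.1
    refine ⟨m, ?_⟩
    simp only [hμ, hM, Finset.mem_filter]
    refine ⟨⟨h1.1, fun x hx hxm => le_antisymm hxm (hm.2 ?_ hxm)⟩, h1.2⟩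
    exact Finset.mem_filter.2 ⟨hx, hxm.trans h1.2⟩
  have hmono : ∀ u v, u ≤ v → μ u ⊆ μ v := fun u v huv m hm =>
    Finset.mem_filter.2 ⟨(Finset.mem_filter.1 hm).1, (Finset.mem_filter.1 hm).2.trans huv⟩
  have hcomp : ∀ u ∈ S, ∀ v ∈ S, ∀ m ∈ μ u, m ∈ μ v → u ≤ v ∨ v ≤ u := by
    intro u hu v hv m hmu hmv
    simp only [hμ, hM, Finset.mem_filter] at hmu hmv
    exact hS m hmu.1.1 u hu v hv hmu.2 hmv.2
  have hex : ∀ v ∈ S, ∃ z ∈ S, μ z = μ v ∧ ∀ x ∈ S, μ x = μ v → z ≤ x := by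
    intro v hv
    obtain ⟨z, hz, hzmin⟩ := exists_least_of_chain (S := S.filter (fun x => μ x = μ v))
      ⟨v, by simp [hv]⟩ (by
        intro x hx y hy
        have hx := Finset.mem_filter.1 hx
        have hy := Finset.mem_filter.1 hy
        obtain ⟨m, hm⟩ := hμne v hv
        exact hcomp x hx.1 y hy.1 m (hx.2 ▸ hm) (hy.2 ▸ hm))
    have hz := Finset.mem_filter.1 hz
    exact ⟨z, hz.1, hz.2, fun x hx hxv => hzmin x (Finset.mem_filter.2 ⟨hx, hxv⟩)⟩
  choose! β hβS hβμ hβmin using hex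
  have hβeq : ∀ u ∈ S, ∀ v ∈ S, μ u = μ v → β u = β v := fun u hu v hv h =>
    le_antisymm (hβmin u hu _ (hβS v hv) ((hβμ v hv).trans h.symm))
      (hβmin v hv _ (hβS u hu) ((hβμ u hu).trans h))
  refine ⟨β, fun v hv => ⟨hβS v hv, hβmin v hv v hv rfl⟩,
    fun v hv => hβeq _ (hβS v hv) _ hv (hβμ v hv), ?_, ?_⟩
  · intro u hu v hv huv
    obtain ⟨m, hm⟩ := hμne u hu
    have hmv : m ∈ μ (β v) := by rw [hβμ v hv]; exact hmono u v huv hm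
    by_cases heq : β u = β v
    · exact .inl heq
    right
    rcases hcomp u hu (β v) (hβS v hv) m hm hmv with h | h
    · refine lt_of_le_of_ne h fun h' => heq ?_
      refine hβeq u hu v hv ?_
      rw [h', hβμ v hv]
    · refine absurd (hβeq u hu v hv ?_) heq
      refine (hmono u v huv).antisymm ?_
      rw [← hβμ v hv]
      exact hmono _ _ h
  · have hcard : (S.image β).card ≤ (S.image μ).card := by
      refine Finset.card_le_card_of_injOn μ ?_ ?_
      · intro y hy
        obtain ⟨v, hv, rfl⟩ := Finset.mem_image.1 hy
        rw [hβμ v hv]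
        exact Finset.mem_image_of_mem _ hv
      · intro y hy y' hy' h
        obtain ⟨v, hv, rfl⟩ := Finset.mem_image.1 hy
        obtain ⟨v', hv', rfl⟩ := Finset.mem_image.1 hy'
        rw [hβμ v hv, hβμ v' hv'] at h
        exact hβeq v hv v' hv' h
    refine hcard.trans (Laminar.card_le ?_ ?_ ?_)
    · intro a ha a' ha'
      obtain ⟨u, hu, rfl⟩ := Finset.mem_image.1 ha
      obtain ⟨v, hv, rfl⟩ := Finset.mem_image.1 ha'
      by_cases h : Disjoint (μ u) (μ v)
      · exact .inr (.inr h)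
      · obtain ⟨m, hmu, hmv⟩ := Finset.not_disjoint_iff.1 h
        rcases hcomp u hu v hv m hmu hmv with h | h
        · exact .inl (hmono _ _ h)
        · exact .inr (.inl (hmono _ _ h))
    · intro a ha
      obtain ⟨u, hu, rfl⟩ := Finset.mem_image.1 ha
      exact hμne u hu
    · intro a ha
      obtain ⟨u, hu, rfl⟩ := Finset.mem_image.1 ha
      exact Finset.filter_subset _ _

/-- A variant of the Ackermann function with slack for counting edges. -/
def growth : ℕ → ℕ → ℕ
  | 0, m => 8 * (m + 2)
  | _ + 1, 0 => 16
  | k + 1, m + 1 => growth k (growth (k + 1) m / 8)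

theorem growth_zero (m : ℕ) : growth 0 m = 8 * (m + 2) := by rw [growth]

theorem growth_succ_zero (k : ℕ) : growth (k + 1) 0 = 16 := by rw [growth]

theorem growth_succ_succ (k m : ℕ) :
    growth (k + 1) (m + 1) = growth k (growth (k + 1) m / 8) := by rw [growth]

theorem sixteen_le_growth (k m : ℕ) : 16 ≤ growth k m := by
  induction k generalizing m with
  | zero => rw [growth_zero]; omega
  | succ k ih =>
    cases m with
    | zero => rw [growth_succ_zero]
    | succ m => rw [growth_succ_succ]; exact ih _

theorem growth_mono (k : ℕ) : Monotone (growth k) := by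
  induction k with
  | zero => intro a b h; rw [growth_zero, growth_zero]; omega
  | succ k ih =>
    refine monotone_nat_of_le_succ fun m => ?_
    induction m with
    | zero => rw [growth_succ_zero]; exact sixteen_le_growth _ _
    | succ m ihm =>
      rw [growth_succ_succ, growth_succ_succ]
      exact ih (Nat.div_le_div_right ihm)

theorem ack_le_growth (k m : ℕ) : 8 * (ack k m + 1) ≤ growth k (m + 1) := by
  induction k generalizing m with
  | zero => rw [growth_zero, ack_zero]; omega
  | succ k ih =>
    induction m with
    | zero =>
      rw [growth_succ_succ, growth_succ_zero, ack_succ_zero]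
      exact ih 1
    | succ m ihm =>
      rw [growth_succ_succ, ack_succ_succ]
      exact (ih _).trans (growth_mono k (by omega))

theorem ForestOn.mono {V : Type*} [PartialOrder V] {S T : Finset V} (hS : ForestOn S)
    (h : T ⊆ S) : ForestOn T :=
  fun x hx y hy z hz => hS x (h hx) y (h hy) z (h hz)

open Classical in
theorem ForestOn.exists_next {V : Type*} [PartialOrder V] {S A : Finset V} (hS : ForestOn S)
    (hA : A ⊆ S) {x : V} (hx : x ∈ S) (h : ∃ y ∈ A, x < y) :
    ∃ z ∈ A, x < z ∧ ∀ y ∈ A, x < y → z ≤ y := by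
  obtain ⟨y, hy, hxy⟩ := h
  obtain ⟨z, hz, hmin⟩ := exists_least_of_chain (S := A.filter (fun y => x < y))
    ⟨y, Finset.mem_filter.2 ⟨hy, hxy⟩⟩ (by
      intro a ha b hb
      have ha := Finset.mem_filter.1 ha
      have hb := Finset.mem_filter.1 hb
      exact hS x hx a (hA ha.1) b (hA hb.1) ha.2.le hb.2.le)
  have hz := Finset.mem_filter.1 hz
  exact ⟨z, hz.1, hz.2, fun y hy hxy => hmin y (Finset.mem_filter.2 ⟨hy, hxy⟩)⟩

open Classical in
theorem ForestOn.exists_greatest {V : Type*} [PartialOrder V] {S A : Finset V} (hS : ForestOn S)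
    (hA : A ⊆ S) {x : V} (hx : x ∈ S) (h : ∃ y ∈ A, x ≤ y) :
    ∃ z ∈ A, x ≤ z ∧ ∀ y ∈ A, x ≤ y → y ≤ z := by
  obtain ⟨y, hy, hxy⟩ := h
  obtain ⟨z, hz⟩ := (A.filter (fun y => x ≤ y)).exists_maximal ⟨y, Finset.mem_filter.2 ⟨hy, hxy⟩⟩
  have hz1 := Finset.mem_filter.1 hz.1
  refine ⟨z, hz1.1, hz1.2, fun y hy hxy => ?_⟩
  rcases hS x hx y (hA hy) z (hA hz1.1) hxy hz1.2 with h | h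
  · exact h
  · exact hz.2 (Finset.mem_filter.2 ⟨hy, hxy⟩) h

open Classical in
theorem exists_all_pairs {V : Type*} [PartialOrder V] (r : V → ℝ) (hr0 : ∀ x, 0 ≤ r x)
    (S : Finset V) (hr : ∀ x ∈ S, ∀ y ∈ S, x < y → 2 * r x ≤ r y) :
    ∃ E : Finset (V × V), (∀ e ∈ E, e.1 ∈ S ∧ e.2 ∈ S ∧ e.1 < e.2) ∧
      E.card ≤ S.card * S.card ∧
      ∀ u ∈ S, ∀ v ∈ S, u ≤ v → Climb E r 1 (4 * r v - 2 * r u) u v := by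
  refine ⟨(S ×ˢ S).filter (fun e => e.1 < e.2), ?_, ?_, ?_⟩
  · intro e he
    simp only [Finset.mem_filter, Finset.mem_product] at he
    exact ⟨he.1.1, he.1.2, he.2⟩
  · exact (Finset.card_filter_le _ _).trans (Finset.card_product _ _).le
  · intro u hu v hv huv
    rcases huv.eq_or_lt with rfl | huv
    · exact .refl (by linarith [hr0 u])
    · have := hr u hu v hv huv
      exact (Climb.up (by simp [hu, hv, huv]) (by linarith [hr0 u])).mono le_rfl
        (by linarith [hr0 v])

open Classical in
theorem card_minimal_mul_le {V : Type*} [PartialOrder V] {S T : Finset V} (hS : ForestOn S)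
    (hT : T ⊆ S) (b : ℕ) (hb : ∀ v ∈ T, b ≤ (S.filter (fun x => x ≤ v)).card) :
    (T.filter (fun m => ∀ x ∈ T, x ≤ m → x = m)).card * b ≤ S.card := by
  set M := T.filter (fun m => ∀ x ∈ T, x ≤ m → x = m) with hM
  have h1 : ∑ m ∈ M, (S.filter (fun x => x ≤ m)).card =
      (M.biUnion (fun m => S.filter (fun x => x ≤ m))).card := by
    rw [Finset.card_biUnion]
    intro m hm m' hm' hne
    rw [Function.onFun, Finset.disjoint_left]
    intro x hx hx'
    simp only [hM, Finset.mem_filter, Finset.mem_coe] at hx hx' hm hm'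
    rcases hS x hx.1 m (hT hm.1) m' (hT hm'.1) hx.2 hx'.2 with h | h
    · exact hne (hm'.2 m hm.1 h)
    · exact hne (hm.2 m' hm'.1 h).symm
  calc M.card * b = ∑ m ∈ M, b := by simp
    _ ≤ ∑ m ∈ M, (S.filter (fun x => x ≤ m)).card :=
      Finset.sum_le_sum fun m hm => hb m (Finset.mem_filter.1 hm).1
    _ = _ := h1
    _ ≤ S.card := Finset.card_le_card (Finset.biUnion_subset.2 fun m _ => Finset.filter_subset _ _)

open Classical in
/-- Shortcuts in a forest with linearly many edges and few hops. -/
theorem exists_shortcuts {V : Type*} [PartialOrder V] (r : V → ℝ) (hr0 : ∀ x, 0 ≤ r x)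
    (k m : ℕ) (S : Finset V) (hS : ForestOn S)
    (hr : ∀ x ∈ S, ∀ y ∈ S, x < y → 2 * r x ≤ r y) (hcard : S.card ≤ growth k m) :
    ∃ E : Finset (V × V), (∀ e ∈ E, e.1 ∈ S ∧ e.2 ∈ S ∧ e.1 < e.2) ∧
      E.card ≤ 16 * (m + 1) * S.card ∧
      ∀ u ∈ S, ∀ v ∈ S, u ≤ v → Climb E r (3 * k + 1) (4 * r v - 2 * r u) u v := by
  induction k generalizing m S with
  | zero =>
    obtain ⟨E, h1, h2, h3⟩ := exists_all_pairs r hr0 S hr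
    refine ⟨E, h1, h2.trans (Nat.mul_le_mul_right _ ?_), h3⟩
    rw [growth_zero] at hcard
    omega
  | succ k ihk =>
    induction m generalizing S with
    | zero =>
      obtain ⟨E, h1, h2, h3⟩ := exists_all_pairs r hr0 S hr
      refine ⟨E, h1, h2.trans (Nat.mul_le_mul_right _ ?_), fun u hu v hv huv =>
        (h3 u hu v hv huv).mono (by omega) le_rfl⟩
      rw [growth_succ_zero] at hcard
      omega
    | succ m ihm =>
      rcases S.eq_empty_or_nonempty with rfl | ⟨x₀, -⟩
      · exact ⟨∅, by simp, by simp, by simp⟩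
      have hV : Nonempty V := ⟨x₀⟩
      rw [growth_succ_succ] at hcard
      set b := growth (k + 1) m with hb
      have hb16 : 16 ≤ b := sixteen_le_growth _ _
      set s : V → ℕ := fun v => (S.filter (fun x => x ≤ v)).card with hs
      have hsmono : ∀ u v, u ≤ v → s u ≤ s v := fun u v huv =>
        Finset.card_le_card (Finset.monotone_filter_right _ fun x _ hx => le_trans hx huv)
      set B := S.filter (fun v => s v ≤ b) with hB
      set T := S.filter (fun v => ¬ s v ≤ b) with hT
      have hBS : B ⊆ S := Finset.filter_subset _ _
      have hTS : T ⊆ S := Finset.filter_subset _ _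
      have hBT : B.card + T.card = S.card := Finset.card_filter_add_card_filter_not _
      have hroot : ∀ x ∈ B, ∃ z ∈ B, x ≤ z ∧ ∀ y ∈ B, x ≤ y → y ≤ z := fun x hx =>
        hS.exists_greatest hBS (hBS hx) ⟨x, hx, le_rfl⟩
      choose! root hrootB hroot_le hroot_max using hroot
      have hsmall : ∀ R ∈ B.image root, ∃ E : Finset (V × V),
          (∀ e ∈ E, e.1 ∈ B.filter (fun x => root x = R) ∧
            e.2 ∈ B.filter (fun x => root x = R) ∧ e.1 < e.2) ∧
          E.card ≤ 16 * (m + 1) * (B.filter (fun x => root x = R)).card ∧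
          ∀ u ∈ B.filter (fun x => root x = R), ∀ v ∈ B.filter (fun x => root x = R), u ≤ v →
            Climb E r (3 * (k + 1) + 1) (4 * r v - 2 * r u) u v := by
        intro R hR
        obtain ⟨x, hx, rfl⟩ := Finset.mem_image.1 hR
        have hsub : B.filter (fun y => root y = root x) ⊆ S := (Finset.filter_subset _ _).trans hBS
        refine ihm _ (hS.mono hsub) (fun u hu v hv => hr u (hsub hu) v (hsub hv)) ?_
        refine (Finset.card_le_card ?_).trans (Finset.mem_filter.1 (hrootB x hx)).2
        intro y hy
        have hy := Finset.mem_filter.1 hy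
        exact Finset.mem_filter.2 ⟨hBS hy.1, hy.2 ▸ hroot_le y hy.1⟩
      choose! E₁ hE₁ hE₁card hE₁climb using hsmall
      obtain ⟨β, hβ, hββ, hβlt, hβcard⟩ := exists_contraction (hS.mono hTS)
      set K := T.image β with hK
      have hKT : K ⊆ T := by
        intro y hy
        obtain ⟨x, hx, rfl⟩ := Finset.mem_image.1 hy
        exact (hβ x hx).1
      have hKS := hKT.trans hTS
      obtain ⟨E₂, hE₂, hE₂card, hE₂climb⟩ := ihk (b / 8) K (hS.mono hKS)
        (fun u hu v hv => hr u (hKS hu) v (hKS hv)) ((Finset.card_le_card hKS).trans hcard)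
      have hM := card_minimal_mul_le hS hTS b
        (fun v hv => (not_le.1 (Finset.mem_filter.1 hv).2).le)
      have hupT : ∀ x, x ∈ B ∧ (∃ y ∈ T, x < y) → ∃ z ∈ T, x < z ∧ ∀ y ∈ T, x < y → z ≤ y :=
        fun x hx => hS.exists_next hTS (hBS hx.1) hx.2
      choose! up hupmem huplt hupmin using hupT
      have hnextK : ∀ x, x ∈ T ∧ (∃ y ∈ K, x < y) → ∃ z ∈ K, x < z ∧ ∀ y ∈ K, x < y → z ≤ y :=
        fun x hx => hS.exists_next hKS (hTS hx.1) hx.2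
      choose! γ hγmem hγlt hγmin using hnextK
      set E₃ := (B.filter (fun x => ∃ y ∈ T, x < y)).image (fun x => (x, up x)) with hE₃
      set E₄ := (T.filter (fun x => ∃ y ∈ K, x < y)).image (fun x => (x, γ x)) with hE₄
      set E₅ := (T.filter (fun x => β x < x)).image (fun x => (β x, x)) with hE₅
      set E := (B.image root).biUnion E₁ ∪ E₂ ∪ E₃ ∪ E₄ ∪ E₅ with hE
      have hEmem : ∀ e ∈ E, e.1 ∈ S ∧ e.2 ∈ S ∧ e.1 < e.2 := by
        intro e he
        simp only [hE, Finset.mem_union] at he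
        rcases he with (((he | he) | he) | he) | he
        · obtain ⟨R, hR, he⟩ := Finset.mem_biUnion.1 he
          obtain ⟨h1, h2, h3⟩ := hE₁ R hR e he
          exact ⟨hBS (Finset.mem_filter.1 h1).1, hBS (Finset.mem_filter.1 h2).1, h3⟩
        · obtain ⟨h1, h2, h3⟩ := hE₂ e he
          exact ⟨hKS h1, hKS h2, h3⟩
        · obtain ⟨x, hx, rfl⟩ := Finset.mem_image.1 he
          have hx := Finset.mem_filter.1 hx
          exact ⟨hBS hx.1, hTS (hupmem x hx), huplt x hx⟩
        · obtain ⟨x, hx, rfl⟩ := Finset.mem_image.1 he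
          have hx := Finset.mem_filter.1 hx
          exact ⟨hTS hx.1, hKS (hγmem x hx), hγlt x hx⟩
        · obtain ⟨x, hx, rfl⟩ := Finset.mem_image.1 he
          have hx := Finset.mem_filter.1 hx
          exact ⟨hTS (hβ x hx.1).1, hTS hx.1, hx.2⟩
      have hTT : ∀ u ∈ T, ∀ v ∈ T, u ≤ v → Climb E r (3 * k + 3) (4 * r v - 2 * r u) u v := by
        intro u hu v hv huv
        have hbot : ∀ v ∈ T, Climb E r 1 (2 * (r v - r (β v))) (β v) v ∧ r (β v) ≤ r v ∧
            Climb E r 1 (r v) v (β v) := by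
          intro v hv
          rcases (hβ v hv).2.eq_or_lt with h | h
          · rw [h]; exact ⟨.refl (by simp), le_rfl, .refl (hr0 v)⟩
          · have h2 := hr _ (hTS (hβ v hv).1) v (hTS hv) h
            have h3 := hr0 (β v)
            have hmem : (β v, v) ∈ E := Finset.mem_union_right _
              (Finset.mem_image.2 ⟨v, Finset.mem_filter.2 ⟨hv, h⟩, rfl⟩)
            exact ⟨(Climb.up hmem (by linarith)).mono le_rfl (by linarith), by linarith,
              Climb.down hmem (by linarith)⟩
        obtain ⟨h1, h2, -⟩ := hbot v hv
        rcases huv.eq_or_lt with rfl | hlt₀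
        · exact .refl (by linarith [hr0 u])
        have huv' := hr u (hTS hu) v (hTS hv) hlt₀
        rcases hβlt u hu v hv huv with heq | hlt
        · rw [← heq] at h1 h2
          exact ((hbot u hu).2.2.trans h1).mono (by omega) (by linarith [hr0 (β u), hr0 u])
        · have hKv : β v ∈ K := Finset.mem_image_of_mem _ hv
          have hu' : u ∈ T ∧ ∃ y ∈ K, u < y := ⟨hu, _, hKv, hlt⟩
          have hγ := hγmem u hu'
          have h3 := hr u (hTS hu) _ (hKS hγ) (hγlt u hu')
          have h4 : Climb E r 1 (r (γ u)) u (γ u) := by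
            refine Climb.up ?_ (by linarith [hr0 u])
            exact Finset.mem_union_left _ (Finset.mem_union_right _
              (Finset.mem_image.2 ⟨u, Finset.mem_filter.2 hu', rfl⟩))
          have h5 : Climb E r (3 * k + 1) (4 * r (β v) - 2 * r (γ u)) (γ u) (β v) := by
            refine (hE₂climb _ hγ _ hKv (hγmin u hu' _ hKv hlt)).subset ?_
            intro e he
            simp [hE, he]
          refine ((h4.trans h5).trans h1).mono (by omega) ?_
          linarith
      refine ⟨E, hEmem, ?_, ?_⟩
      · have hc1 : ((B.image root).biUnion E₁).card ≤ 16 * (m + 1) * B.card := by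
          refine Finset.card_biUnion_le.trans ((Finset.sum_le_sum hE₁card).trans ?_)
          rw [← Finset.mul_sum, Finset.card_eq_sum_card_image root B]
        have hc3 : E₃.card ≤ B.card := Finset.card_image_le.trans (Finset.card_filter_le _ _)
        have hc4 : E₄.card ≤ T.card := Finset.card_image_le.trans (Finset.card_filter_le _ _)
        have hc5 : E₅.card ≤ T.card := Finset.card_image_le.trans (Finset.card_filter_le _ _)
        have hcE : E.card ≤ ((B.image root).biUnion E₁).card + E₂.card + E₃.card + E₄.card +
            E₅.card := by
          refine (Finset.card_union_le _ _).trans (Nat.add_le_add_right ?_ _)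
          refine (Finset.card_union_le _ _).trans (Nat.add_le_add_right ?_ _)
          refine (Finset.card_union_le _ _).trans (Nat.add_le_add_right ?_ _)
          exact Finset.card_union_le _ _
        have hc2 : E₂.card ≤ 6 * S.card := by
          have h8 : 16 * (b / 8 + 1) ≤ 3 * b := by omega
          calc E₂.card ≤ 16 * (b / 8 + 1) * K.card := hE₂card
            _ ≤ 3 * b * K.card := Nat.mul_le_mul_right _ h8
            _ ≤ 3 * b * (2 * _) := Nat.mul_le_mul_left _ hβcard
            _ = 6 * (_ * b) := by ring
            _ ≤ 6 * S.card := Nat.mul_le_mul_left _ hM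
        have hc1' : 16 * (m + 1) * B.card ≤ 16 * (m + 1) * S.card :=
          Nat.mul_le_mul_left _ (by omega)
        have : 16 * (m + 1 + 1) * S.card = 16 * (m + 1) * S.card + 16 * S.card := by ring
        omega
      · intro u hu v hv huv
        by_cases hvb : s v ≤ b
        · have hub : s u ≤ b := (hsmono u v huv).trans hvb
          have huB : u ∈ B := Finset.mem_filter.2 ⟨hu, hub⟩
          have hvB : v ∈ B := Finset.mem_filter.2 ⟨hv, hvb⟩
          have h1 : root v ≤ root u :=
            hroot_max u huB _ (hrootB v hvB) (huv.trans (hroot_le v hvB))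
          have h2 : root u ≤ root v :=
            hroot_max v hvB _ (hrootB u huB) ((hroot_le v hvB).trans h1)
          have hR : root v ∈ B.image root := Finset.mem_image_of_mem _ hvB
          refine (hE₁climb (root v) hR u (Finset.mem_filter.2 ⟨huB, le_antisymm h2 h1⟩) v
            (Finset.mem_filter.2 ⟨hvB, rfl⟩) huv).subset ?_
          intro e he
          simp only [hE, Finset.mem_union]
          exact .inl (.inl (.inl (.inl (Finset.mem_biUnion.2 ⟨_, hR, he⟩))))
        · have hvT : v ∈ T := Finset.mem_filter.2 ⟨hv, hvb⟩
          by_cases hub : s u ≤ b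
          · have huB : u ∈ B := Finset.mem_filter.2 ⟨hu, hub⟩
            have hlt : u < v := lt_of_le_of_ne huv (by rintro rfl; exact hvb hub)
            have hu' : u ∈ B ∧ ∃ y ∈ T, u < y := ⟨huB, v, hvT, hlt⟩
            have h3 := hr u hu _ (hTS (hupmem u hu')) (huplt u hu')
            have h4 : Climb E r 1 (r (up u)) u (up u) := by
              refine Climb.up ?_ (by linarith [hr0 u])
              exact Finset.mem_union_left _ (Finset.mem_union_left _ (Finset.mem_union_right _
                (Finset.mem_image.2 ⟨u, Finset.mem_filter.2 hu', rfl⟩)))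
            refine (h4.trans (hTT _ (hupmem u hu') v hvT (hupmin u hu' v hvT hlt))).mono
              (by omega) (by linarith)
          · exact (hTT u (Finset.mem_filter.2 ⟨hu, hub⟩) v hvT huv).mono (by omega) le_rfl

open Classical in
/-- Shortcuts inside a forest with a greatest element and at most `b` minimal elements. All
elements are close to a hub `h`, the closer the larger their weights are. -/
theorem exists_component {V : Type*} [PartialOrder V] (r : V → ℝ) (hr0 : ∀ x, 0 ≤ r x) {b : ℕ}
    (hb : 2 ≤ b) (T k : ℕ) (hk : 2 * b ≤ growth k 1) (S : Finset V) (hS : ForestOn S)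
    (hr : ∀ x ∈ S, ∀ y ∈ S, x < y → 2 * r x ≤ r y) (w : V → ℕ) (hw : ∀ x ∈ S, 1 ≤ w x)
    (hsum : ∀ C ⊆ S, (∀ x ∈ C, ∀ y ∈ C, x ≤ y ∨ y ≤ x) → ∑ x ∈ C, w x < 2 * b ^ T)
    (hmin : (S.filter (fun m => ∀ x ∈ S, x ≤ m → x = m)).card ≤ b)
    (R : V) (hR : R ∈ S) (hRmax : ∀ x ∈ S, x ≤ R) :
    ∃ (E : Finset (V × V)) (h : V), h ∈ S ∧ (∀ e ∈ E, e.1 ∈ S ∧ e.2 ∈ S ∧ e.1 < e.2) ∧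
      E.card ≤ 34 * S.card ∧ ∑ e ∈ E, r e.2 ≤ ∑ x ∈ S, r x + 66 * b * r R ∧
      (∀ v, (E.filter (fun e => e.1 = v ∨ e.2 = v)).card ≤ 71 * b) ∧
      (∀ x ∈ S, ∀ l, b ^ l ≤ w x → ∃ j, j + l ≤ T + 2 ∧ Climb E r j (3 * r R) x h) ∧
      ∀ u ∈ S, ∀ v ∈ S, u ≤ v → Climb E r (2 * (T + 1) + (3 * k + 1)) (8 * r v) u v := by
  have hr' : ∀ x ∈ S, ∀ y ∈ S, x ≤ y → r x ≤ r y := by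
    intro x hx y hy hxy
    rcases hxy.eq_or_lt with rfl | h
    · exact le_rfl
    · linarith [hr x hx y hy h, hr0 x]
  obtain ⟨β, hβ, hββ, hβlt, hβcard⟩ := exists_contraction hS
  set K := S.image β with hK
  have hKS : K ⊆ S := by
    intro y hy
    obtain ⟨x, hx, rfl⟩ := Finset.mem_image.1 hy
    exact (hβ x hx).1
  have hKb : K.card ≤ 2 * b := hβcard.trans (by omega)
  have hKβ : ∀ z ∈ K, β z = z := by
    intro y hy
    obtain ⟨x, hx, rfl⟩ := Finset.mem_image.1 hy
    exact hββ x hx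
  have hheap : ∀ z ∈ K, ∃ E : Finset (V × V),
      (∀ e ∈ E, e.1 ∈ S.filter (fun x => β x = z) ∧ e.2 ∈ S.filter (fun x => β x = z) ∧
        e.1 < e.2) ∧
      (∀ v, (E.filter (fun e => e.2 = v)).card ≤ 1) ∧
      (∀ v, (E.filter (fun e => e.1 = v)).card ≤ 4 * b) ∧
      ∀ x ∈ S.filter (fun x => β x = z), ∀ l, b ^ l ≤ w x →
        ∃ k, k + l ≤ T + 1 ∧ Climb E r k (2 * (r x - r z)) x z := by
    intro z hz
    have hsub : S.filter (fun x => β x = z) ⊆ S := Finset.filter_subset _ _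
    have hzle : ∀ x ∈ S.filter (fun x => β x = z), z ≤ x := by
      intro x hx
      have hx := Finset.mem_filter.1 hx
      exact hx.2 ▸ (hβ x hx.1).2
    have hchain : ∀ x ∈ S.filter (fun x => β x = z), ∀ y ∈ S.filter (fun x => β x = z),
        x ≤ y ∨ y ≤ x := fun x hx y hy =>
      hS z (hKS hz) x (hsub hx) y (hsub hy) (hzle x hx) (hzle y hy)
    exact exists_heap r w hb T _ hchain (fun x hx y hy => hr x (hsub hx) y (hsub hy)) hr0
      (fun x hx => hw x (hsub hx)) (hsum _ hsub hchain) z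
      (Finset.mem_filter.2 ⟨hKS hz, hKβ z hz⟩) hzle
  choose! E₁ hE₁ hE₁snd hE₁fst hE₁climb using hheap
  obtain ⟨E₂, hE₂, hE₂card, hE₂climb⟩ := exists_shortcuts r hr0 k 1 K (hS.mono hKS)
    (fun u hu v hv => hr u (hKS hu) v (hKS hv)) (hKb.trans hk)
  set h := β R with hh
  have hhK : h ∈ K := Finset.mem_image_of_mem _ hR
  set E₃ := (K.filter (fun x => x < h)).image (fun x => (x, h)) with hE₃
  set H := K.biUnion E₁ with hH
  have hHmem : ∀ e ∈ H, e.1 ∈ S ∧ e.2 ∈ S ∧ e.1 < e.2 ∧ e ∈ E₁ (β e.1) ∧ e ∈ E₁ (β e.2) := by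
    intro e he
    obtain ⟨z, hz, he⟩ := Finset.mem_biUnion.1 he
    obtain ⟨h1, h2, h3⟩ := hE₁ z hz e he
    have h1 := Finset.mem_filter.1 h1
    have h2 := Finset.mem_filter.1 h2
    exact ⟨h1.1, h2.1, h3, h1.2.symm ▸ he, h2.2.symm ▸ he⟩
  have hHsnd : ∀ v, (H.filter (fun e => e.2 = v)).card ≤ 1 := by
    intro v
    by_cases hv : v ∈ S
    · refine (Finset.card_le_card ?_).trans (hE₁snd (β v) (Finset.mem_image_of_mem _ hv) v)
      intro e he
      have he := Finset.mem_filter.1 he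
      exact Finset.mem_filter.2 ⟨he.2 ▸ (hHmem e he.1).2.2.2.2, he.2⟩
    · rw [Finset.card_eq_zero.2]
      · exact zero_le_one
      · exact Finset.filter_eq_empty_iff.2 fun e he hev => hv (hev ▸ (hHmem e he).2.1)
  have hHfst : ∀ v, (H.filter (fun e => e.1 = v)).card ≤ 4 * b := by
    intro v
    by_cases hv : v ∈ S
    · refine (Finset.card_le_card ?_).trans (hE₁fst (β v) (Finset.mem_image_of_mem _ hv) v)
      intro e he
      have he := Finset.mem_filter.1 he
      exact Finset.mem_filter.2 ⟨he.2 ▸ (hHmem e he.1).2.2.2.1, he.2⟩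
    · rw [Finset.card_eq_zero.2]
      · exact Nat.zero_le _
      · exact Finset.filter_eq_empty_iff.2 fun e he hev => hv (hev ▸ (hHmem e he).1)
  have hHinj : Set.InjOn Prod.snd (H : Set (V × V)) := by
    intro e he e' he' heq
    exact Finset.card_le_one.1 (hHsnd e'.2) e (Finset.mem_filter.2 ⟨he, heq⟩) e'
      (Finset.mem_filter.2 ⟨he', rfl⟩)
  have hHimg : H.image Prod.snd ⊆ S := by
    intro v hv
    obtain ⟨e, he, rfl⟩ := Finset.mem_image.1 hv
    exact (hHmem e he).2.1
  have hE₃mem : ∀ e ∈ E₃, e.1 ∈ S ∧ e.2 ∈ S ∧ e.1 < e.2 := by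
    intro e he
    obtain ⟨x, hx, rfl⟩ := Finset.mem_image.1 he
    have hx := Finset.mem_filter.1 hx
    exact ⟨hKS hx.1, hKS hhK, hx.2⟩
  have hE₂mem : ∀ e ∈ E₂, e.1 ∈ S ∧ e.2 ∈ S ∧ e.1 < e.2 := fun e he =>
    ⟨hKS (hE₂ e he).1, hKS (hE₂ e he).2.1, (hE₂ e he).2.2⟩
  have hE₃card : E₃.card ≤ K.card := Finset.card_image_le.trans (Finset.card_filter_le _ _)
  have hG : (E₂ ∪ E₃).card ≤ 33 * K.card :=
    (Finset.card_union_le _ _).trans (by omega)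
  have hGmem : ∀ e ∈ E₂ ∪ E₃, e.1 ∈ S ∧ e.2 ∈ S ∧ e.1 < e.2 := fun e he =>
    (Finset.mem_union.1 he).elim (hE₂mem e) (hE₃mem e)
  have hsubH : H ⊆ H ∪ (E₂ ∪ E₃) := Finset.subset_union_left
  have hclimb : ∀ x ∈ S, ∀ l, b ^ l ≤ w x → ∃ j, j + l ≤ T + 1 ∧
      Climb (H ∪ (E₂ ∪ E₃)) r j (2 * r x - 2 * r (β x)) x (β x) := by
    intro x hx l hl
    have hβK := Finset.mem_image_of_mem β hx
    obtain ⟨j, hj, hcl⟩ := hE₁climb (β x) hβK x (Finset.mem_filter.2 ⟨hx, rfl⟩) l hl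
    refine ⟨j, hj, ?_⟩
    rw [← mul_sub]
    exact hcl.subset ((Finset.subset_biUnion_of_mem E₁ hβK).trans hsubH)
  have hclimb0 : ∀ x ∈ S,
      Climb (H ∪ (E₂ ∪ E₃)) r (T + 1) (2 * r x - 2 * r (β x)) x (β x) := by
    intro x hx
    obtain ⟨j, hj, hcl⟩ := hclimb x hx 0 (by simpa using hw x hx)
    exact hcl.mono (by omega) le_rfl
  refine ⟨H ∪ (E₂ ∪ E₃), h, hKS hhK, ?_, ?_, ?_, ?_, ?_, ?_⟩
  · intro e he
    rcases Finset.mem_union.1 he with he | he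
    · exact ⟨(hHmem e he).1, (hHmem e he).2.1, (hHmem e he).2.2.1⟩
    · exact hGmem e he
  · refine (Finset.card_union_le _ _).trans ?_
    have h1 : H.card ≤ S.card := by
      rw [← Finset.card_image_of_injOn hHinj]
      exact Finset.card_le_card hHimg
    have h2 := Finset.card_le_card hKS
    omega
  · have h1 : ∑ e ∈ H, r e.2 ≤ ∑ x ∈ S, r x := by
      rw [← Finset.sum_image (f := r) hHinj]
      exact Finset.sum_le_sum_of_subset_of_nonneg hHimg fun x _ _ => hr0 x
    have h2 : ∑ e ∈ E₂ ∪ E₃, r e.2 ≤ 66 * b * r R := by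
      have h3 : ∑ e ∈ E₂ ∪ E₃, r e.2 ≤ (E₂ ∪ E₃).card • r R :=
        Finset.sum_le_card_nsmul _ _ _ fun e he =>
          hr' _ (hGmem e he).2.1 _ hR (hRmax _ (hGmem e he).2.1)
      have h4 : ((E₂ ∪ E₃).card : ℝ) ≤ 66 * b := by
        exact_mod_cast hG.trans (by omega : 33 * K.card ≤ 66 * b)
      rw [nsmul_eq_mul] at h3
      exact h3.trans (mul_le_mul_of_nonneg_right h4 (hr0 R))
    have h3 : ∑ e ∈ H ∪ (E₂ ∪ E₃), r e.2 + ∑ e ∈ H ∩ (E₂ ∪ E₃), r e.2 =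
        ∑ e ∈ H, r e.2 + ∑ e ∈ E₂ ∪ E₃, r e.2 := Finset.sum_union_inter
    have h4 : 0 ≤ ∑ e ∈ H ∩ (E₂ ∪ E₃), r e.2 := Finset.sum_nonneg fun e _ => hr0 _
    linarith
  · intro v
    have h1 : (H ∪ (E₂ ∪ E₃)).filter (fun e => e.1 = v ∨ e.2 = v) ⊆
        (H.filter (fun e => e.1 = v) ∪ H.filter (fun e => e.2 = v)) ∪ (E₂ ∪ E₃) := by
      intro e he
      simp only [Finset.mem_filter, Finset.mem_union] at he ⊢
      tauto
    refine (Finset.card_le_card h1).trans ((Finset.card_union_le _ _).trans ?_)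
    have h2 := Finset.card_union_le (H.filter (fun e => e.1 = v)) (H.filter (fun e => e.2 = v))
    have h3 := hHfst v
    have h4 := hHsnd v
    omega
  · intro x hx l hl
    obtain ⟨j, hj, hcl⟩ := hclimb x hx l hl
    have hβK := Finset.mem_image_of_mem β hx
    have h1 : Climb (H ∪ (E₂ ∪ E₃)) r 1 (r h) (β x) h := by
      have := hβlt (β x) (hβ x hx).1 R hR ((hβ x hx).2.trans (hRmax x hx))
      rw [hββ x hx] at this
      rcases this with heq | hlt
      · rw [heq]; exact .refl (hr0 _)
      · refine Climb.up ?_ (hr' _ (hβ x hx).1 _ (hKS hhK) hlt.le)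
        refine Finset.mem_union_right _ (Finset.mem_union_right _ ?_)
        exact Finset.mem_image.2 ⟨β x, Finset.mem_filter.2 ⟨hβK, hlt⟩, rfl⟩
    refine ⟨j + 1, by omega, (hcl.trans h1).mono le_rfl ?_⟩
    linarith [hr0 (β x), hr' x hx R hR (hRmax x hx), hr' h (hKS hhK) R hR (hRmax _ (hKS hhK))]
  · intro u hu v hv huv
    have h1 := hclimb0 u hu
    have h2 := (hclimb0 v hv).reverse
    have h3 := hr' u hu v hv huv
    have h4 := hr0 (β u)
    have h5 := hr0 (β v)
    have h6 := hr' _ (hβ v hv).1 v hv (hβ v hv).2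
    rcases hβlt u hu v hv huv with heq | hlt
    · rw [heq] at h1 h4
      exact (h1.trans h2).mono (by omega) (by linarith [hr0 v])
    · have h7 := (hE₂climb (β u) (Finset.mem_image_of_mem _ hu) (β v)
        (Finset.mem_image_of_mem _ hv) ((hβ u hu).2.trans hlt.le)).subset
        (Finset.subset_union_left.trans Finset.subset_union_right : E₂ ⊆ H ∪ (E₂ ∪ E₃))
      exact ((h1.trans h7).trans h2).mono (by omega) (by linarith)

theorem Laminar.forestOn {α : Type*} {F : Finset (Finset α)} (hF : Laminar F)
    (hne : ∀ v ∈ F, v.Nonempty) : ForestOn F := by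
  intro x hx y hy z hz hxy hxz
  rcases hF y hy z hz with h | h | h
  · exact .inl h
  · exact .inr h
  · obtain ⟨p, hp⟩ := hne x hx
    exact (Finset.disjoint_left.1 h (hxy hp) (hxz hp)).elim

open Classical in
/-- The points of `u` that are in no proper subset of `u` belonging to `F` and of the same order
of magnitude as `u`. -/
noncomputable def ownPart {α : Type*} (b : ℕ) (F : Finset (Finset α)) (u : Finset α) : Finset α :=
  u \ (F.filter (fun v => v ⊂ u ∧ Nat.log b v.card = Nat.log b u.card)).biUnion id

open Classical in
theorem Laminar.exists_component {α : Type*} {F : Finset (Finset α)} (hF : Laminar F)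
    (hne : ∀ v ∈ F, v.Nonempty) (r : Finset α → ℝ) (hr0 : ∀ x, 0 ≤ r x)
    (hr : ∀ x ∈ F, ∀ y ∈ F, x < y → 2 * r x ≤ r y) {b : ℕ} (hb : 2 ≤ b) (k : ℕ)
    (hk : 2 * b ≤ growth k 1) (R : Finset α) (hR : R ∈ F) (S : Finset (Finset α))
    (hS : ∀ x, x ∈ S ↔ x ∈ F ∧ x ≤ R ∧ Nat.log b x.card = Nat.log b R.card) :
    ∃ (E : Finset (Finset α × Finset α)) (h : Finset α), h ∈ S ∧
      (∀ e ∈ E, e.1 ∈ S ∧ e.2 ∈ S ∧ e.1 < e.2) ∧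
      E.card ≤ 34 * S.card ∧ ∑ e ∈ E, r e.2 ≤ ∑ x ∈ S, r x + 66 * b * r R ∧
      (∀ v, (E.filter (fun e => e.1 = v ∨ e.2 = v)).card ≤ 71 * b) ∧
      (∀ x ∈ S, ∀ l, b ^ l ≤ (ownPart b F x).card + 1 →
        ∃ j, j + l ≤ Nat.log b R.card + 3 ∧ Climb E r j (3 * r R) x h) ∧
      ∀ u ∈ S, ∀ v ∈ S, u ≤ v →
        Climb E r (2 * (Nat.log b R.card + 2) + (3 * k + 1)) (8 * r v) u v := by
  have hSF : S ⊆ F := fun x hx => ((hS x).1 hx).1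
  have hcardR : R.card < b ^ (Nat.log b R.card + 1) := Nat.lt_pow_succ_log_self hb _
  have main := Stmt1.exists_component r hr0 hb (Nat.log b R.card + 1) k hk S
    ((hF.forestOn hne).mono hSF) (fun x hx y hy => hr x (hSF hx) y (hSF hy))
    (fun u => (ownPart b F u).card + 1) (fun _ _ => Nat.le_add_left _ _) ?_ ?_ R
    ((hS R).2 ⟨hR, le_rfl, rfl⟩) (fun x hx => ((hS x).1 hx).2.1)
  · obtain ⟨E, h, h1, h2, h3, h4, h5, h6, h7⟩ := main
    refine ⟨E, h, h1, h2, h3, h4, fun v => ?_, h6, h7⟩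
    convert h5 v
  · intro C hC hchain
    rw [Finset.sum_add_distrib]
    have h1 : ∑ x ∈ C, (ownPart b F x).card ≤ R.card := by
      rw [← Finset.card_biUnion]
      · refine Finset.card_le_card (Finset.biUnion_subset.2 fun x hx => ?_)
        exact Finset.sdiff_subset.trans ((hS x).1 (hC hx)).2.1
      · have key : ∀ x ∈ C, ∀ y ∈ C, x ≤ y → x ≠ y →
            Disjoint (ownPart b F x) (ownPart b F y) := by
          intro x hx y hy hxy hne
          have hx' := (hS x).1 (hC hx)
          have hy' := (hS y).1 (hC hy)
          refine Finset.disjoint_left.2 fun p hp hq => (Finset.mem_sdiff.1 hq).2 ?_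
          refine Finset.mem_biUnion.2 ⟨x, Finset.mem_filter.2 ⟨hx'.1, ?_, ?_⟩,
            (Finset.mem_sdiff.1 hp).1⟩
          · exact lt_of_le_of_ne hxy hne
          · rw [hx'.2.2, hy'.2.2]
        intro x hx y hy hne
        rcases hchain x hx y hy with h | h
        · exact key x hx y hy h hne
        · exact (key y hy x hx h hne.symm).symm
    have h2 : ∑ x ∈ C, 1 ≤ R.card := by
      rw [← Finset.card_eq_sum_ones]
      have : (C.image Finset.card).card = C.card := by
        refine Finset.card_image_of_injOn fun x hx y hy hxy => ?_
        rcases hchain x hx y hy with h | h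
        · exact Finset.eq_of_subset_of_card_le h hxy.ge
        · exact (Finset.eq_of_subset_of_card_le h hxy.le).symm
      rw [← this]
      have h3 : C.image Finset.card ⊆ Finset.Icc 1 R.card := by
        intro n hn
        obtain ⟨x, hx, rfl⟩ := Finset.mem_image.1 hn
        have hx' := (hS x).1 (hC hx)
        exact Finset.mem_Icc.2 ⟨(hne x hx'.1).card_pos, Finset.card_le_card hx'.2.1⟩
      simpa using Finset.card_le_card h3
    omega
  · set M := S.filter (fun m => ∀ x ∈ S, x ≤ m → x = m) with hM
    have h1 : M.card * b ^ Nat.log b R.card ≤ R.card := by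
      calc M.card * b ^ Nat.log b R.card = ∑ m ∈ M, b ^ Nat.log b R.card := by simp
        _ ≤ ∑ m ∈ M, m.card := by
          refine Finset.sum_le_sum fun m hm => ?_
          have hm' := (hS m).1 (Finset.mem_filter.1 hm).1
          rw [← hm'.2.2]
          exact Nat.pow_log_le_self b (hne m hm'.1).card_pos.ne'
        _ = (M.biUnion id).card := by
          refine (Finset.card_biUnion fun m hm m' hm' hmm' => ?_).symm
          have h1 := Finset.mem_filter.1 hm
          have h2 := Finset.mem_filter.1 hm'
          rcases hF m (hSF h1.1) m' (hSF h2.1) with h | h | h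
          · exact (hmm' (h2.2 m h1.1 h)).elim
          · exact (hmm' (h1.2 m' h2.1 h).symm).elim
          · exact h
        _ ≤ R.card := Finset.card_le_card (Finset.biUnion_subset.2 fun m hm =>
          ((hS m).1 (Finset.mem_filter.1 hm).1).2.1)
    rw [pow_succ'] at hcardR
    have h2 : M.card ≤ b := (Nat.lt_of_mul_lt_mul_right (h1.trans_lt hcardR)).le
    convert h2

theorem sum_biUnion_le {ι κ : Type*} [DecidableEq κ] (s : Finset ι) (t : ι → Finset κ) (f : κ → ℝ)
    (hf : ∀ x, 0 ≤ f x) : ∑ x ∈ s.biUnion t, f x ≤ ∑ i ∈ s, ∑ x ∈ t i, f x := by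
  classical
  induction s using Finset.induction_on with
  | empty => simp
  | insert a s ha ih =>
    rw [Finset.biUnion_insert, Finset.sum_insert ha]
    have h1 : ∑ x ∈ t a ∪ s.biUnion t, f x + ∑ x ∈ t a ∩ s.biUnion t, f x =
        ∑ x ∈ t a, f x + ∑ x ∈ s.biUnion t, f x := Finset.sum_union_inter
    have h2 : 0 ≤ ∑ x ∈ t a ∩ s.biUnion t, f x := Finset.sum_nonneg fun x _ => hf x
    linarith

set_option maxHeartbeats 1000000 in
open Classical in
/-- Shortcuts in a laminar family: few edges, small degree, small weight, and cheap short walks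
between nested members. -/
theorem Laminar.exists_shortcuts {α : Type*} [Fintype α] {F : Finset (Finset α)} (hF : Laminar F)
    (hne : ∀ v ∈ F, v.Nonempty) (r : Finset α → ℝ) (hr0 : ∀ x, 0 ≤ r x)
    (hr : ∀ x ∈ F, ∀ y ∈ F, x < y → 2 * r x ≤ r y) (D : ℕ)
    (hD : ∀ v ∈ F, (F.filter (fun u => u < v ∧ ∀ x ∈ F, u < x → v ≤ x)).card ≤ D) (M : ℝ)
    (hM : ∀ A ⊆ F, (∀ u ∈ A, ∀ v ∈ A, u ≠ v → Disjoint u v) → ∑ u ∈ A, r u ≤ M)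
    {b : ℕ} (hb : 2 ≤ b) (T : ℕ) (hT : Fintype.card α < b ^ T) (k : ℕ)
    (hk : 2 * b ≤ growth k 1) :
    ∃ E : Finset (Finset α × Finset α), (∀ e ∈ E, e.1 ∈ F ∧ e.2 ∈ F ∧ e.1 < e.2) ∧
      E.card ≤ 35 * F.card ∧ ∑ e ∈ E, r e.2 ≤ (D + 1) * ∑ x ∈ F, r x + 66 * b * (T * M) ∧
      (∀ v, (E.filter (fun e => e.1 = v ∨ e.2 = v)).card ≤ 71 * b + D + 1) ∧
      ∀ u ∈ F, ∀ v ∈ F, u ≤ v → Climb E r (7 * T + 3 * k) (13 * r v) u v := by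
  have hfor := hF.forestOn hne
  set ℓ : Finset α → ℕ := fun v => Nat.log b v.card with hℓ
  have hℓmono : ∀ u v : Finset α, u ≤ v → ℓ u ≤ ℓ v := fun u v huv =>
    Nat.log_mono_right (Finset.card_le_card huv)
  have hℓT : ∀ v, ∀ _ : v ∈ F, ℓ v < T := fun v hv =>
    Nat.log_lt_of_lt_pow (hne v hv).card_pos.ne' ((Finset.card_le_univ v).trans_lt hT)
  have hr' : ∀ x ∈ F, ∀ y ∈ F, x ≤ y → r x ≤ r y := by
    intro x hx y hy hxy
    rcases hxy.eq_or_lt with rfl | h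
    · exact le_rfl
    · linarith [hr x hx y hy h, hr0 x]
  have hroot : ∀ v ∈ F, ∃ z ∈ F.filter (fun x => ℓ x = ℓ v), v ≤ z ∧
      ∀ y ∈ F.filter (fun x => ℓ x = ℓ v), v ≤ y → y ≤ z := fun v hv =>
    hfor.exists_greatest (Finset.filter_subset _ _) hv ⟨v, Finset.mem_filter.2 ⟨hv, rfl⟩, le_rfl⟩
  choose! root hroot_mem hroot_le hroot_max using hroot
  have hrootF : ∀ v ∈ F, root v ∈ F := fun v hv => (Finset.mem_filter.1 (hroot_mem v hv)).1
  have hrootℓ : ∀ v ∈ F, ℓ (root v) = ℓ v := fun v hv => (Finset.mem_filter.1 (hroot_mem v hv)).2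
  have hroot_eq : ∀ u ∈ F, ∀ v ∈ F, u ≤ v → ℓ u = ℓ v → root u = root v := by
    intro u hu v hv huv huvℓ
    have h1 : root v ≤ root u := hroot_max u hu _
      (Finset.mem_filter.2 ⟨hrootF v hv, by rw [hrootℓ v hv, huvℓ]⟩) (huv.trans (hroot_le v hv))
    have h2 : root u ≤ root v := hroot_max v hv _
      (Finset.mem_filter.2 ⟨hrootF u hu, by rw [hrootℓ u hu, huvℓ]⟩) ((hroot_le v hv).trans h1)
    exact le_antisymm h2 h1
  have hrr : ∀ v ∈ F, root (root v) = root v := fun v hv =>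
    (hroot_eq v hv _ (hrootF v hv) (hroot_le v hv) (hrootℓ v hv).symm).symm
  set 𝓡 := F.image root with h𝓡
  have h𝓡F : ∀ R ∈ 𝓡, R ∈ F ∧ root R = R := by
    intro R hR
    obtain ⟨v, hv, rfl⟩ := Finset.mem_image.1 hR
    exact ⟨hrootF v hv, hrr v hv⟩
  have hcomp := fun R (hR : R ∈ 𝓡) => hF.exists_component hne r hr0 hr hb k hk R (h𝓡F R hR).1
    (F.filter (fun x => root x = R)) (by
      intro x
      rw [Finset.mem_filter]
      refine and_congr_right fun hx => ⟨?_, fun h => ?_⟩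
      · rintro rfl
        exact ⟨hroot_le x hx, (hrootℓ x hx).symm⟩
      · exact (hroot_eq x hx R (h𝓡F R hR).1 h.1 h.2).trans (h𝓡F R hR).2)
  choose! E₁ h hhmem hE₁ hE₁card hE₁sum hE₁deg hE₁hub hE₁climb using hcomp
  have hhF : ∀ R ∈ 𝓡, h R ∈ F ∧ root (h R) = R := fun R hR => Finset.mem_filter.1 (hhmem R hR)
  have hpar : ∀ x, x ∈ F ∧ (∃ y ∈ F, x < y) → ∃ z ∈ F, x < z ∧ ∀ y ∈ F, x < y → z ≤ y :=
    fun x hx => hfor.exists_next (Finset.Subset.refl _) hx.1 hx.2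
  choose! par hparF hparlt hparmin using hpar
  set 𝓛 := 𝓡.filter (fun R => ∃ y ∈ F, R < y) with h𝓛
  have h𝓛' : ∀ R ∈ 𝓛, R ∈ 𝓡 ∧ (R ∈ F ∧ ∃ y ∈ F, R < y) := fun R hR =>
    ⟨(Finset.mem_filter.1 hR).1, (h𝓡F R (Finset.mem_filter.1 hR).1).1,
      (Finset.mem_filter.1 hR).2⟩
  have hhle : ∀ R ∈ 𝓡, h R ≤ R := fun R hR => by
    conv_rhs => rw [← (hhF R hR).2]
    exact hroot_le _ (hhF R hR).1
  set E₂ := 𝓛.image (fun R => (h R, par R)) with hE₂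
  have hE₂mem : ∀ e ∈ E₂, e.1 ∈ F ∧ e.2 ∈ F ∧ e.1 < e.2 := by
    intro e he
    obtain ⟨R, hR, rfl⟩ := Finset.mem_image.1 he
    have hR := h𝓛' R hR
    exact ⟨(hhF R hR.1).1, hparF R hR.2, (hhle R hR.1).trans_lt (hparlt R hR.2)⟩
  set H := 𝓡.biUnion E₁ with hH
  have hHmem : ∀ e ∈ H, (e.1 ∈ F ∧ e.2 ∈ F ∧ e.1 < e.2) ∧ e ∈ E₁ (root e.1) ∧
      e ∈ E₁ (root e.2) := by
    intro e he
    obtain ⟨R, hR, he⟩ := Finset.mem_biUnion.1 he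
    obtain ⟨h1, h2, h3⟩ := hE₁ R hR e he
    have h1 := Finset.mem_filter.1 h1
    have h2 := Finset.mem_filter.1 h2
    exact ⟨⟨h1.1, h2.1, h3⟩, h1.2.symm ▸ he, h2.2.symm ▸ he⟩
  have hstep : ∀ p ∈ F, ∀ v ∈ F, p ≤ v → ∃ u ∈ F, p ≤ u ∧ u ≤ v ∧ ℓ u = ℓ v ∧
      (u = p ∨ ∃ c ∈ 𝓛, p ≤ c ∧ ℓ c < ℓ v ∧ par c = u ∧
        b ^ ℓ c ≤ (ownPart b F u).card + 1) := by
    intro p hp v hv hpv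
    obtain ⟨u, hu, humin⟩ := exists_least_of_chain
      (S := F.filter (fun x => p ≤ x ∧ ℓ x = ℓ v)) ⟨v, Finset.mem_filter.2 ⟨hv, hpv, rfl⟩⟩ (by
        intro x hx y hy
        have hx := Finset.mem_filter.1 hx
        have hy := Finset.mem_filter.1 hy
        exact hfor p hp x hx.1 y hy.1 hx.2.1 hy.2.1)
    obtain ⟨huF, hpu, huℓ⟩ := Finset.mem_filter.1 hu
    refine ⟨u, huF, hpu, humin v (Finset.mem_filter.2 ⟨hv, hpv, rfl⟩), huℓ, ?_⟩
    by_cases hup : u = p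
    · exact .inl hup
    right
    have hpℓ : ℓ p < ℓ v := by
      refine lt_of_le_of_ne (hℓmono p v hpv) fun h => hup ?_
      exact le_antisymm (humin p (Finset.mem_filter.2 ⟨hp, le_rfl, h⟩)) hpu
    obtain ⟨c, hc, hpc, hcmax⟩ := hfor.exists_greatest (A := F.filter (fun x => ℓ x < ℓ v))
      (Finset.filter_subset _ _) hp ⟨p, Finset.mem_filter.2 ⟨hp, hpℓ⟩, le_rfl⟩
    obtain ⟨hcF, hcℓ⟩ := Finset.mem_filter.1 hc
    have hcu : c < u := by
      rcases hfor p hp c hcF u huF hpc hpu with h | h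
      · refine lt_of_le_of_ne h ?_
        rintro rfl
        omega
      · have := hℓmono u c h
        omega
    have hcR : c ∈ 𝓡 := by
      refine Finset.mem_image.2 ⟨c, hcF, le_antisymm ?_ (hroot_le c hcF)⟩
      exact hcmax _ (Finset.mem_filter.2 ⟨hrootF c hcF, (hrootℓ c hcF).trans_lt hcℓ⟩)
        (hpc.trans (hroot_le c hcF))
    have hc' : c ∈ F ∧ ∃ y ∈ F, c < y := ⟨hcF, u, huF, hcu⟩
    refine ⟨c, Finset.mem_filter.2 ⟨hcR, hc'.2⟩, hpc, hcℓ, ?_, ?_⟩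
    · have h1 : par c ≤ u := hparmin c hc' u huF hcu
      refine le_antisymm h1 (humin _ (Finset.mem_filter.2 ⟨hparF c hc', ?_, ?_⟩))
      · exact hpc.trans (hparlt c hc').le
      · refine le_antisymm ((hℓmono _ _ h1).trans huℓ.le) (not_lt.1 fun hlt => ?_)
        exact (hparlt c hc').not_ge (hcmax _ (Finset.mem_filter.2 ⟨hparF c hc', hlt⟩)
          (hpc.trans (hparlt c hc').le))
    · have hsub : c ⊆ ownPart b F u := by
        intro x hx
        refine Finset.mem_sdiff.2 ⟨hcu.le hx, fun hx' => ?_⟩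
        obtain ⟨y, hy, hxy⟩ := Finset.mem_biUnion.1 hx'
        obtain ⟨hyF, hyu, hyℓ⟩ := Finset.mem_filter.1 hy
        rcases hF c hcF y hyF with h | h | h
        · refine hyu.not_ge (humin y (Finset.mem_filter.2 ⟨hyF, hpc.trans h, ?_⟩))
          exact hyℓ.trans huℓ
        · have := hℓmono y c h
          have : ℓ y = ℓ u := hyℓ
          omega
        · exact Finset.disjoint_left.1 h hx hxy
      have := Finset.card_le_card hsub
      have := Nat.pow_log_le_self b (hne c hcF).card_pos.ne'
      simp only [hℓ]
      omega
  have hsubE₁ : ∀ R ∈ 𝓡, E₁ R ⊆ H ∪ E₂ := fun R hR =>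
    (Finset.subset_biUnion_of_mem E₁ hR).trans Finset.subset_union_left
  have hlink : ∀ c ∈ 𝓛, Climb (H ∪ E₂) r 1 (r (par c)) (h c) (par c) := by
    intro c hc
    refine Climb.up (Finset.mem_union_right _ (Finset.mem_image_of_mem _ hc)) ?_
    have hmem := hE₂mem _ (Finset.mem_image_of_mem _ hc)
    exact hr' _ hmem.1 _ hmem.2.1 hmem.2.2.le
  have hhub : ∀ n, ∀ R ∈ 𝓡, ℓ R = n → ∀ p ∈ F, p ≤ R →
      Climb (H ∪ E₂) r (5 * n + 3) (8 * r R) p (h R) := by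
    intro n
    induction n using Nat.strong_induction_on with
    | _ n ih =>
      intro R hR hn p hp hpR
      have hRF := (h𝓡F R hR).1
      obtain ⟨u, huF, hpu, huR, huℓ, hcase⟩ := hstep p hp R hRF hpR
      have huS : u ∈ F.filter (fun x => root x = R) := Finset.mem_filter.2
        ⟨huF, (hroot_eq u huF R hRF huR huℓ).trans (h𝓡F R hR).2⟩
      rcases hcase with rfl | ⟨c, hc, hpc, hcℓ, rfl, hown⟩
      · obtain ⟨j, hj, hcl⟩ := hE₁hub R hR u huS 0 (by simp)
        refine (hcl.subset (hsubE₁ R hR)).mono ?_ (by linarith [hr0 R])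
        have : Nat.log b R.card = n := hn
        omega
      · obtain ⟨hc𝓡, hc'⟩ := h𝓛' c hc
        have h1 := ih (ℓ c) (hn ▸ hcℓ) c hc𝓡 rfl p hp hpc
        obtain ⟨j, hj, hcl⟩ := hE₁hub R hR _ huS (ℓ c) hown
        have h2 := hr c hc'.1 _ huF (hparlt c hc')
        have h3 := hr' _ huF R hRF huR
        refine ((h1.trans (hlink c hc)).trans (hcl.subset (hsubE₁ R hR))).mono ?_ (by linarith)
        have : Nat.log b R.card = n := hn
        omega
  have hchildren : ∀ v ∈ F, (𝓛.filter (fun R => par R = v)).card ≤ D := by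
    intro v hv
    refine (Finset.card_le_card fun R hR => ?_).trans (hD v hv)
    obtain ⟨hR𝓛, rfl⟩ := Finset.mem_filter.1 hR
    have hR := (h𝓛' R hR𝓛).2
    exact Finset.mem_filter.2 ⟨hR.1, hparlt R hR, hparmin R hR⟩
  have hEmem : ∀ e ∈ H ∪ E₂, e.1 ∈ F ∧ e.2 ∈ F ∧ e.1 < e.2 := by
    intro e he
    rcases Finset.mem_union.1 he with he | he
    · exact (hHmem e he).1
    · exact hE₂mem e he
  refine ⟨H ∪ E₂, hEmem, ?_, ?_, ?_, ?_⟩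
  · have h1 : H.card ≤ 34 * F.card := by
      refine Finset.card_biUnion_le.trans ((Finset.sum_le_sum hE₁card).trans ?_)
      rw [← Finset.mul_sum, Finset.card_eq_sum_card_image root F]
    have h2 : E₂.card ≤ F.card := Finset.card_image_le.trans
      ((Finset.card_filter_le _ _).trans Finset.card_image_le)
    exact (Finset.card_union_le _ _).trans (by omega)
  · have h1 : ∑ e ∈ H, r e.2 ≤ ∑ x ∈ F, r x + 66 * b * (T * M) := by
      have h2 : ∑ e ∈ H, r e.2 ≤ ∑ R ∈ 𝓡, ∑ e ∈ E₁ R, r e.2 :=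
        sum_biUnion_le 𝓡 E₁ (fun e => r e.2) fun _ => hr0 _
      have h3 : ∑ R ∈ 𝓡, ∑ x ∈ F with root x = R, r x = ∑ x ∈ F, r x :=
        Finset.sum_fiberwise_of_maps_to (fun x hx => Finset.mem_image_of_mem _ hx) _
      have h4 : ∑ R ∈ 𝓡, r R ≤ T * M := by
        rw [← Finset.sum_fiberwise_of_maps_to (t := Finset.range T) (g := ℓ)
          (fun R hR => Finset.mem_range.2 (hℓT R (h𝓡F R hR).1))]
        have h5 : ∀ l ∈ Finset.range T, ∑ R ∈ 𝓡 with ℓ R = l, r R ≤ M := by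
          intro l _
          refine hM _ (fun R hR => (h𝓡F R (Finset.mem_filter.1 hR).1).1) ?_
          intro u hu v hv huv
          obtain ⟨hu, hul⟩ := Finset.mem_filter.1 hu
          obtain ⟨hv, hvl⟩ := Finset.mem_filter.1 hv
          have hu' := h𝓡F u hu
          have hv' := h𝓡F v hv
          rcases hF u hu'.1 v hv'.1 with h | h | h
          · exact (huv (hu'.2 ▸ hv'.2 ▸ hroot_eq u hu'.1 v hv'.1 h (hul.trans hvl.symm))).elim
          · exact (huv (hu'.2 ▸ hv'.2 ▸ hroot_eq v hv'.1 u hu'.1 h (hvl.trans hul.symm)).symm).elim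
          · exact h
        simpa using Finset.sum_le_sum h5
      calc _ ≤ _ := h2
        _ ≤ ∑ R ∈ 𝓡, (∑ x ∈ F with root x = R, r x + 66 * b * r R) := Finset.sum_le_sum hE₁sum
        _ = ∑ x ∈ F, r x + 66 * b * ∑ R ∈ 𝓡, r R := by
          rw [Finset.sum_add_distrib, h3, Finset.mul_sum]
        _ ≤ _ := by gcongr
    have h2 : ∑ e ∈ E₂, r e.2 ≤ D * ∑ x ∈ F, r x := by
      calc ∑ e ∈ E₂, r e.2 ≤ ∑ R ∈ 𝓛, r (par R) :=
            Finset.sum_image_le_of_nonneg fun _ _ => hr0 _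
        _ = ∑ v ∈ F, ∑ R ∈ 𝓛 with par R = v, r (par R) :=
            (Finset.sum_fiberwise_of_maps_to (fun R hR => hparF R (h𝓛' R hR).2) _).symm
        _ ≤ ∑ v ∈ F, D * r v := by
            refine Finset.sum_le_sum fun v hv => ?_
            have h3 : ∑ R ∈ 𝓛 with par R = v, r (par R) =
                (𝓛.filter (fun R => par R = v)).card * r v := by
              rw [← nsmul_eq_mul]
              exact Finset.sum_eq_card_nsmul fun R hR => by rw [(Finset.mem_filter.1 hR).2]
            rw [h3]
            refine mul_le_mul_of_nonneg_right ?_ (hr0 v)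
            exact_mod_cast hchildren v hv
        _ = _ := by rw [Finset.mul_sum]
    have h3 : ∑ e ∈ H ∪ E₂, r e.2 + ∑ e ∈ H ∩ E₂, r e.2 =
        ∑ e ∈ H, r e.2 + ∑ e ∈ E₂, r e.2 := Finset.sum_union_inter
    have h4 : 0 ≤ ∑ e ∈ H ∩ E₂, r e.2 := Finset.sum_nonneg fun e _ => hr0 _
    linarith
  · intro v
    by_cases hv : v ∈ F
    · have h1 : (H ∪ E₂).filter (fun e => e.1 = v ∨ e.2 = v) ⊆
          ((E₁ (root v)).filter (fun e => e.1 = v ∨ e.2 = v) ∪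
            (𝓛.filter (fun R => par R = v)).image (fun R => (h R, par R))) ∪
            {(h (root v), par (root v))} := by
        intro e hmem
        obtain ⟨hmem', hev⟩ := Finset.mem_filter.1 hmem
        rcases Finset.mem_union.1 hmem' with he | he
        · refine Finset.mem_union_left _ (Finset.mem_union_left _ (Finset.mem_filter.2 ⟨?_, hev⟩))
          rcases hev with rfl | rfl
          · exact (hHmem e he).2.1
          · exact (hHmem e he).2.2
        · obtain ⟨R, hR, rfl⟩ := Finset.mem_image.1 he
          rcases hev with hev | hev
          · refine Finset.mem_union_right _ (Finset.mem_singleton.2 ?_)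
            have : root v = R := hev ▸ (hhF R (h𝓛' R hR).1).2
            rw [this]
          · exact Finset.mem_union_left _ (Finset.mem_union_right _
              (Finset.mem_image_of_mem _ (Finset.mem_filter.2 ⟨hR, hev⟩)))
      refine (Finset.card_le_card h1).trans ((Finset.card_union_le _ _).trans ?_)
      rw [Finset.card_singleton]
      refine Nat.add_le_add_right ((Finset.card_union_le _ _).trans (Nat.add_le_add ?_ ?_)) 1
      · exact hE₁deg (root v) (Finset.mem_image_of_mem _ hv) v
      · exact Finset.card_image_le.trans (hchildren v hv)
    · rw [Finset.card_eq_zero.2]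
      · exact Nat.zero_le _
      · refine Finset.filter_eq_empty_iff.2 fun e he hev => hv ?_
        rcases hev with rfl | rfl
        · exact (hEmem e he).1
        · exact (hEmem e he).2.1
  · intro p hp v hv hpv
    obtain ⟨u, huF, hpu, huv, huℓ, hcase⟩ := hstep p hp v hv hpv
    have hR : root v ∈ 𝓡 := Finset.mem_image_of_mem _ hv
    have h1 := (hE₁climb (root v) hR u
      (Finset.mem_filter.2 ⟨huF, hroot_eq u huF v hv huv huℓ⟩) v
      (Finset.mem_filter.2 ⟨hv, rfl⟩) huv).subset (hsubE₁ _ hR)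
    have h0 : Nat.log b (root v).card < T := hℓT _ (hrootF v hv)
    rcases hcase with rfl | ⟨c, hc, hpc, hcℓ, rfl, -⟩
    · exact h1.mono (by omega) (by linarith [hr0 v])
    · obtain ⟨hc𝓡, hc'⟩ := h𝓛' c hc
      have h2 := hhub _ c hc𝓡 rfl p hp hpc
      have h3 := hr c hc'.1 _ huF (hparlt c hc')
      have h4 := hr' _ huF v hv huv
      have h5 := hℓT v hv
      exact ((h2.trans (hlink c hc)).trans h1).mono (by omega) (by linarith)

section Metric

variable {P : Type} [MetricSpace P]

theorem DoublingDimLE.card_le {d : ℕ} (h : DoublingDimLE P d) (j : ℕ) (x : P) (R s : ℝ)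
    (A : Finset P) (hA : ∀ y ∈ A, dist y x < R) (hs : ∀ y ∈ A, ∀ z ∈ A, y ≠ z → s ≤ dist y z)
    (hR : 2 * R ≤ 2 ^ j * s) : A.card ≤ (2 ^ d) ^ j := by
  classical
  induction j generalizing x R A with
  | zero =>
    rw [pow_zero]
    refine Finset.card_le_one.2 fun y hy z hz => ?_
    by_contra hne
    have h1 := hs y hy z hz hne
    have h2 := dist_triangle_right y z x
    have h3 := hA y hy
    have h4 := hA z hz
    simp only [pow_zero, one_mul] at hR
    linarith
  | succ j ih =>
    obtain ⟨S, hS, hcov⟩ := h x R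
    have h1 : A ⊆ S.biUnion (fun z => A.filter (fun y => dist y z < R / 2)) := by
      intro y hy
      obtain ⟨z, hz, hyz⟩ := Set.mem_iUnion₂.1 (hcov (Metric.mem_ball.2 (hA y hy)))
      exact Finset.mem_biUnion.2 ⟨z, hz, Finset.mem_filter.2 ⟨hy, hyz⟩⟩
    calc A.card ≤ _ := Finset.card_le_card h1
      _ ≤ ∑ z ∈ S, (A.filter (fun y => dist y z < R / 2)).card := Finset.card_biUnion_le
      _ ≤ ∑ z ∈ S, (2 ^ d) ^ j := by
        refine Finset.sum_le_sum fun z _ => ih z (R / 2) _ (fun y hy => (Finset.mem_filter.1 hy).2)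
          (fun y hy w hw => hs y (Finset.mem_filter.1 hy).1 w (Finset.mem_filter.1 hw).1) ?_
        rw [pow_succ] at hR
        linarith
      _ = S.card * (2 ^ d) ^ j := by simp
      _ ≤ 2 ^ d * (2 ^ d) ^ j := Nat.mul_le_mul_right _ hS
      _ = _ := by ring

/-- The variation of a function along an edge. -/
def edgeVariation {α : Type*} (φ : α → ℝ) (e : Sym2 α) : ℝ :=
  Sym2.lift ⟨fun p q => |φ p - φ q|, fun _ _ => abs_sub_comm _ _⟩ e

theorem edgeVariation_nonneg {α : Type*} (φ : α → ℝ) (e : Sym2 α) : 0 ≤ edgeVariation φ e := by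
  induction e with
  | _ p q => exact abs_nonneg _

theorem edgeWeight_nonneg (e : Sym2 P) : 0 ≤ edgeWeight e := by
  induction e with
  | _ p q => exact dist_nonneg

theorem abs_sub_le_sum_edgeVariation {α : Type} {T : Finset (Sym2 α)} (hT : IsConnectedOn T)
    (φ : α → ℝ)
    (p q : α) : |φ p - φ q| ≤ ∑ e ∈ T, edgeVariation φ e := by
  classical
  set G := SimpleGraph.fromEdgeSet (T : Set (Sym2 α)) with hG
  have hreach : G.Reachable p q := by
    obtain ⟨k, x, hx0, hxk, hx⟩ := hT p q
    have : ∀ i : Fin (k + 1), G.Reachable p (x i) := by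
      intro i
      induction i using Fin.induction with
      | zero => rw [hx0]
      | succ i ih =>
        by_cases heq : x i.castSucc = x i.succ
        · rwa [← heq]
        · exact ih.trans (SimpleGraph.Adj.reachable
            ((SimpleGraph.fromEdgeSet_adj _).2 ⟨hx i, heq⟩))
    exact hxk ▸ this (Fin.last k)
  obtain ⟨w, hw⟩ := hreach.exists_isPath
  have h1 : ∀ {a b : α} (w : G.Walk a b), |φ a - φ b| ≤ (w.edges.map (edgeVariation φ)).sum := by
    intro a b w
    induction w with
    | nil => simp
    | cons hadj w ih =>
      rw [SimpleGraph.Walk.edges_cons, List.map_cons, List.sum_cons]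
      refine (abs_sub_le _ _ _).trans (add_le_add le_rfl ih)
  refine (h1 w).trans ?_
  rw [← List.sum_toFinset _ hw.isTrail.edges_nodup]
  refine Finset.sum_le_sum_of_subset_of_nonneg ?_ fun e _ _ => edgeVariation_nonneg φ e
  intro e he
  have := w.edges_subset_edgeSet (List.mem_toFinset.1 he)
  rw [hG, SimpleGraph.edgeSet_fromEdgeSet] at this
  exact this.1

theorem dist_le_totalWeight {T : Finset (Sym2 P)} (hT : IsConnectedOn T) (p q : P) :
    dist p q ≤ totalWeight T := by
  have h := abs_sub_le_sum_edgeVariation hT (fun x => dist x p) q p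
  simp only [dist_self, sub_zero, abs_dist] at h
  rw [dist_comm]
  refine h.trans (Finset.sum_le_sum fun e _ => ?_)
  induction e with
  | _ a b => exact abs_dist_sub_le a b p

/-- Disjoint sets that contain balls and miss a point force weight on every connected graph. -/
theorem sum_radius_le_totalWeight {T : Finset (Sym2 P)} (hT : IsConnectedOn T)
    (A : Finset (Finset P)) (hA : ∀ u ∈ A, ∀ v ∈ A, u ≠ v → Disjoint u v) (ρ : Finset P → ℝ)
    (x : Finset P → P) (hx : ∀ v ∈ A, ∀ q, dist q (x v) < ρ v → q ∈ v)
    (hmiss : ∀ v ∈ A, ∃ y, y ∉ v) : ∑ v ∈ A, ρ v ≤ 2 * totalWeight T := by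
  classical
  set φ : Finset P → P → ℝ := fun v p => max 0 (ρ v - dist p (x v)) with hφ
  have hφ0 : ∀ v ∈ A, ∀ p, p ∉ v → φ v p = 0 := by
    intro v hv p hp
    refine max_eq_left (sub_nonpos.2 (not_lt.1 fun h => hp (hx v hv p h)))
  have hφlip : ∀ v p q, |φ v p - φ v q| ≤ dist p q := by
    intro v p q
    refine (abs_max_sub_max_le_max _ _ _ _).trans (max_le (by simp) ?_)
    rw [sub_sub_sub_cancel_left, abs_sub_comm]
    exact abs_dist_sub_le p q (x v)
  have h1 : ∀ v ∈ A, ρ v ≤ ∑ e ∈ T, edgeVariation (φ v) e := by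
    intro v hv
    obtain ⟨y, hy⟩ := hmiss v hv
    have h := abs_sub_le_sum_edgeVariation hT (φ v) (x v) y
    rw [hφ0 v hv y hy, sub_zero] at h
    refine le_trans ?_ ((le_abs_self _).trans h)
    simp [hφ]
  have hone : ∀ (p : P) (t : ℝ), 0 ≤ t → ∑ v ∈ A, (if p ∈ v then t else 0) ≤ t := by
    intro p t ht
    rw [← Finset.sum_filter, Finset.sum_const, nsmul_eq_mul]
    have : (A.filter (fun v => p ∈ v)).card ≤ 1 := by
      refine Finset.card_le_one.2 fun u hu v hv => ?_
      obtain ⟨hu, hpu⟩ := Finset.mem_filter.1 hu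
      obtain ⟨hv, hpv⟩ := Finset.mem_filter.1 hv
      by_contra hne
      exact Finset.disjoint_left.1 (hA u hu v hv hne) hpu hpv
    have h2 : ((A.filter (fun v => p ∈ v)).card : ℝ) ≤ 1 := by exact_mod_cast this
    nlinarith
  have h2 : ∀ e ∈ T, ∑ v ∈ A, edgeVariation (φ v) e ≤ 2 * edgeWeight e := by
    intro e _
    induction e with
    | _ p q =>
      have h3 : ∀ v ∈ A, edgeVariation (φ v) s(p, q) ≤
          (if p ∈ v then dist p q else 0) + (if q ∈ v then dist p q else 0) := by
        intro v hv
        have h4 : edgeVariation (φ v) s(p, q) ≤ dist p q := hφlip v p q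
        have h5 := dist_nonneg (x := p) (y := q)
        split_ifs with hp hq hq
        · linarith
        · linarith
        · linarith
        · have : edgeVariation (φ v) s(p, q) = |φ v p - φ v q| := rfl
          rw [this, hφ0 v hv p hp, hφ0 v hv q hq]
          simp
      refine (Finset.sum_le_sum h3).trans ?_
      rw [Finset.sum_add_distrib]
      have h4 := hone p (dist p q) dist_nonneg
      have h5 := hone q (dist p q) dist_nonneg
      have : edgeWeight s(p, q) = dist p q := rfl
      linarith
  calc ∑ v ∈ A, ρ v ≤ ∑ v ∈ A, ∑ e ∈ T, edgeVariation (φ v) e := Finset.sum_le_sum h1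
    _ = ∑ e ∈ T, ∑ v ∈ A, edgeVariation (φ v) e := Finset.sum_comm
    _ ≤ ∑ e ∈ T, 2 * edgeWeight e := Finset.sum_le_sum h2
    _ = 2 * totalWeight T := by rw [totalWeight, Finset.mul_sum]

theorem le_mstWeight [Fintype P] [Nonempty P] {w : ℝ}
    (h : ∀ T : Finset (Sym2 P), IsConnectedOn T → w ≤ totalWeight T) : w ≤ mstWeight P := by
  classical
  refine le_csInf ?_ ?_
  · obtain ⟨p₀⟩ := ‹Nonempty P›
    have hT : ∀ p, p ≠ p₀ → s(p₀, p) ∈ (Finset.univ.erase p₀).image (fun p => s(p₀, p)) :=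
      fun p hp => Finset.mem_image.2 ⟨p, by simp [hp], rfl⟩
    refine ⟨_, (Finset.univ.erase p₀).image (fun p => s(p₀, p)), ?_, ?_, ?_, rfl⟩
    · intro e he
      obtain ⟨p, hp, rfl⟩ := Finset.mem_image.1 he
      simpa using (Finset.ne_of_mem_erase hp).symm
    · intro p q
      by_cases hpq : p = q
      · exact ⟨0, fun _ => p, rfl, hpq, fun i => i.elim0⟩
      by_cases hp : p = p₀
      · refine ⟨1, ![p, q], rfl, rfl, fun i => ?_⟩
        fin_cases i
        subst hp
        exact hT q (Ne.symm hpq)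
      by_cases hq : q = p₀
      · refine ⟨1, ![p, q], rfl, rfl, fun i => ?_⟩
        fin_cases i
        subst hq
        rw [Sym2.eq_swap]
        exact hT p hpq
      · refine ⟨2, ![p, p₀, q], rfl, rfl, fun i => ?_⟩
        fin_cases i
        · rw [Sym2.eq_swap]
          exact hT p hp
        · exact hT q hq
    · rw [Finset.card_image_of_injective _ fun a b hab => Sym2.congr_right.1 hab]
      simp
  · rintro _ ⟨T, -, hT, -, rfl⟩
    exact h T hT

end Metric

section Nets

variable {P : Type} [MetricSpace P]

theorem exists_net_map (N : Finset P) (ρ : ℝ) (hρ : 0 < ρ) : ∃ g : P → P,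
    (∀ x ∈ N, g x ∈ N ∧ dist x (g x) < ρ) ∧
    (∀ x ∈ N, ∀ y ∈ N, g x ≠ g y → ρ ≤ dist (g x) (g y)) ∧
    ∀ x ∈ N, ∀ y ∈ N, dist y (g x) < ρ / 2 → g y = g x := by
  classical
  obtain ⟨M, hM⟩ := (N.powerset.filter
    (fun M => ∀ x ∈ M, ∀ y ∈ M, x ≠ y → ρ ≤ dist x y)).exists_maximal ⟨∅, by simp⟩
  obtain ⟨hMN, hMsep⟩ := Finset.mem_filter.1 hM.1
  rw [Finset.mem_powerset] at hMN
  have hcov : ∀ x ∈ N, ∃ y ∈ M, dist x y < ρ := by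
    intro x hx
    by_contra! hfar
    have h1 : insert x M ≤ M := by
      refine hM.2 (Finset.mem_filter.2 ⟨Finset.mem_powerset.2 (Finset.insert_subset hx hMN), ?_⟩)
        (Finset.subset_insert _ _)
      intro a ha b hb hab
      rcases Finset.mem_insert.1 ha with hax | haM <;>
        rcases Finset.mem_insert.1 hb with hbx | hbM
      · exact (hab (hax.trans hbx.symm)).elim
      · exact hax ▸ hfar b hbM
      · rw [dist_comm]; exact hbx ▸ hfar a haM
      · exact hMsep a haM b hbM hab
    have h2 := hfar x (h1 (Finset.mem_insert_self _ _))
    rw [dist_self] at h2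
    linarith
  have hnear : ∀ x ∈ N, ∃ y ∈ M, ∀ z ∈ M, dist x y ≤ dist x z := by
    intro x hx
    obtain ⟨y, hy, -⟩ := hcov x hx
    exact Finset.exists_min_image M (dist x) ⟨y, hy⟩
  choose! g hgM hgmin using hnear
  have hg : ∀ x ∈ N, dist x (g x) < ρ := by
    intro x hx
    obtain ⟨y, hy, hxy⟩ := hcov x hx
    exact (hgmin x hx y hy).trans_lt hxy
  refine ⟨g, fun x hx => ⟨hMN (hgM x hx), hg x hx⟩,
    fun x hx y hy => hMsep _ (hgM x hx) _ (hgM y hy), fun x hx y hy hyx => ?_⟩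
  by_contra hne
  have h1 := hMsep _ (hgM y hy) _ (hgM x hx) hne
  have h2 := hgmin y hy _ (hgM x hx)
  have h3 := dist_triangle_left (g y) (g x) y
  linarith

/-- A hierarchy of nets at the scales `r * B ^ l`, each point having an ancestor in every net. -/
structure NetTree (P : Type) [MetricSpace P] (r B : ℝ) where
  /-- The ancestor at a given level. -/
  anc : ℕ → P → P
  anc_zero : ∀ p, anc 0 p = p
  anc_succ : ∀ l p q, anc l p = anc l q → anc (l + 1) p = anc (l + 1) q
  dist_anc_le : ∀ l p, dist p (anc l p) ≤ 2 * (r * B ^ l)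
  le_dist_anc : ∀ l p q, anc l p ≠ anc l q → r * B ^ l ≤ dist (anc l p) (anc l q)
  anc_eq_of_dist_lt : ∀ l p q, dist q (anc l p) < r * B ^ l / 4 → anc l q = anc l p

theorem exists_netTree [Fintype P] {r B : ℝ} (hr : 0 < r) (hB : 8 ≤ B)
    (hmin : ∀ p q : P, p ≠ q → r ≤ dist p q) : Nonempty (NetTree P r B) := by
  classical
  have hpos : ∀ l, 0 < r * B ^ l := fun l => by positivity
  choose g hg hgsep hgball using fun (N : Finset P) (l : ℕ) => exists_net_map N (r * B ^ l) (hpos l)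
  set anc : ℕ → P → P := fun l => Nat.rec id (fun l a => g (Finset.univ.image a) (l + 1) ∘ a) l
    with hanc
  have hsucc : ∀ l p, anc (l + 1) p = g (Finset.univ.image (anc l)) (l + 1) (anc l p) :=
    fun l p => rfl
  have hmem : ∀ l p, anc l p ∈ Finset.univ.image (anc l) := fun l p =>
    Finset.mem_image_of_mem _ (Finset.mem_univ p)
  have hdist : ∀ l p, dist p (anc l p) ≤ 2 * (r * B ^ l) := by
    intro l p
    induction l with
    | zero =>
      have : anc 0 p = p := rfl
      rw [this, dist_self]
      have := hpos 0
      linarith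
    | succ l ih =>
      have h1 := dist_triangle p (anc l p) (anc (l + 1) p)
      have h2 := (hg (Finset.univ.image (anc l)) (l + 1) _ (hmem l p)).2
      rw [← hsucc] at h2
      have h3 : r * B ^ (l + 1) = B * (r * B ^ l) := by ring
      have h4 := hpos l
      nlinarith
  refine ⟨anc, fun p => rfl, fun l p q h => by rw [hsucc, hsucc, h], hdist, ?_, ?_⟩
  · rintro (_ | l) p q hne
    · rw [pow_zero, mul_one]
      exact hmin p q hne
    · exact hgsep (Finset.univ.image (anc l)) (l + 1) _ (hmem l p) _ (hmem l q) hne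
  · rintro (_ | l) p q hlt
    · by_contra hne
      have h1 := hmin q p hne
      have h2 : dist q p < r * B ^ 0 / 4 := hlt
      rw [pow_zero, mul_one] at h2
      linarith
    · refine hgball (Finset.univ.image (anc l)) (l + 1) _ (hmem l p) _ (hmem l q) ?_
      rw [← hsucc]
      have h1 := dist_triangle_left (anc l q) (anc (l + 1) p) q
      have h2 := hdist l q
      have h3 : r * B ^ (l + 1) = B * (r * B ^ l) := by ring
      have h4 := hpos l
      nlinarith

end Nets

namespace NetTree

variable {P : Type} [MetricSpace P] [Fintype P] {r B : ℝ} (N : NetTree P r B)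

open Classical in
/-- The points with the same ancestor at level `l` as `p`. -/
noncomputable def cluster (l : ℕ) (p : P) : Finset P :=
  Finset.univ.filter (fun q => N.anc l q = N.anc l p)

open Classical in
/-- All clusters of all levels. -/
noncomputable def family : Finset (Finset P) :=
  Finset.univ.filter (fun v => ∃ l p, v = N.cluster l p)

/-- The lowest level at which a set is a cluster. -/
noncomputable def level (v : Finset P) : ℕ := sInf {l | ∃ p, v = N.cluster l p}

/-- The scale of a cluster. -/
noncomputable def scale (v : Finset P) : ℝ := r * B ^ N.level v

theorem mem_cluster {l : ℕ} {p q : P} : q ∈ N.cluster l p ↔ N.anc l q = N.anc l p := by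
  simp [cluster]

theorem self_mem_cluster (l : ℕ) (p : P) : p ∈ N.cluster l p := N.mem_cluster.2 rfl

theorem cluster_eq_of_mem {l : ℕ} {p q : P} (h : q ∈ N.cluster l p) :
    N.cluster l q = N.cluster l p := by
  ext x
  rw [mem_cluster, mem_cluster, N.mem_cluster.1 h]

theorem cluster_mono {l l' : ℕ} (h : l ≤ l') (p : P) : N.cluster l p ⊆ N.cluster l' p := by
  intro q hq
  rw [mem_cluster] at hq ⊢
  induction h with
  | refl => exact hq
  | step _ ih => exact N.anc_succ _ _ _ ih

theorem mem_family {v : Finset P} : v ∈ N.family ↔ ∃ l p, v = N.cluster l p := by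
  simp [family]

theorem cluster_mem_family (l : ℕ) (p : P) : N.cluster l p ∈ N.family :=
  N.mem_family.2 ⟨l, p, rfl⟩

theorem nonempty_of_mem_family {v : Finset P} (hv : v ∈ N.family) : v.Nonempty := by
  obtain ⟨l, p, rfl⟩ := N.mem_family.1 hv
  exact ⟨p, N.self_mem_cluster l p⟩

theorem eq_cluster_level {v : Finset P} (hv : v ∈ N.family) {p : P} (hp : p ∈ v) :
    v = N.cluster (N.level v) p := by
  obtain ⟨q, hq⟩ : N.level v ∈ {l | ∃ p, v = N.cluster l p} := Nat.sInf_mem (N.mem_family.1 hv)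
  have hp' := hp
  rw [hq] at hp'
  exact hq.trans (N.cluster_eq_of_mem hp').symm

theorem level_cluster_le (l : ℕ) (p : P) : N.level (N.cluster l p) ≤ l :=
  Nat.sInf_le ⟨p, rfl⟩

theorem cluster_zero (p : P) : N.cluster 0 p = {p} := by
  ext q
  rw [mem_cluster, N.anc_zero, N.anc_zero, Finset.mem_singleton]

theorem laminar_family : Laminar N.family := by
  intro u hu v hv
  by_cases hd : Disjoint u v
  · exact .inr (.inr hd)
  obtain ⟨x, hxu, hxv⟩ := Finset.not_disjoint_iff.1 hd
  rw [N.eq_cluster_level hu hxu, N.eq_cluster_level hv hxv]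
  rcases le_total (N.level u) (N.level v) with h | h
  · exact .inl (N.cluster_mono h x)
  · exact .inr (.inl (N.cluster_mono h x))

theorem level_lt {u v : Finset P} (hu : u ∈ N.family) (hv : v ∈ N.family) (huv : u < v) :
    N.level u < N.level v := by
  by_contra! hle
  obtain ⟨x, hx⟩ := N.nonempty_of_mem_family hu
  refine huv.not_ge ?_
  rw [N.eq_cluster_level hu hx, N.eq_cluster_level hv (huv.le hx)]
  exact N.cluster_mono hle x

theorem scale_pos (hr : 0 < r) (hB : 8 ≤ B) (v : Finset P) : 0 < N.scale v := by
  unfold scale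
  positivity

theorem two_mul_scale_le (hr : 0 < r) (hB : 8 ≤ B) {u v : Finset P} (hu : u ∈ N.family)
    (hv : v ∈ N.family) (huv : u < v) : 2 * N.scale u ≤ N.scale v := by
  have h1 : B ^ (N.level u + 1) ≤ B ^ N.level v :=
    pow_le_pow_right₀ (by linarith) (N.level_lt hu hv huv)
  have h2 : 0 < B ^ N.level u := by positivity
  unfold scale
  have h3 : r * B ^ (N.level u + 1) ≤ r * B ^ N.level v := mul_le_mul_of_nonneg_left h1 hr.le
  have h4 : r * B ^ (N.level u + 1) = B * (r * B ^ N.level u) := by ring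
  have h5 : 0 < r * B ^ N.level u := by positivity
  nlinarith

theorem dist_anc_le_of_mem {l : ℕ} {p q : P} (hq : q ∈ N.cluster l p) :
    dist q (N.anc l p) ≤ 2 * (r * B ^ l) :=
  N.mem_cluster.1 hq ▸ N.dist_anc_le l q

theorem dist_le_of_mem {v : Finset P} (hv : v ∈ N.family) {p q : P} (hp : p ∈ v) (hq : q ∈ v) :
    dist p q ≤ 4 * N.scale v := by
  have h1 := N.dist_anc_le (N.level v) p
  rw [N.eq_cluster_level hv hp] at hq
  have h2 := N.dist_anc_le_of_mem hq
  have h3 := dist_triangle_right p q (N.anc (N.level v) p)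
  unfold scale
  linarith

theorem univ_mem_family [Nonempty P] (hr : 0 < r) (hB : 8 ≤ B) : Finset.univ ∈ N.family := by
  obtain ⟨p⟩ := ‹Nonempty P›
  obtain ⟨D, hD⟩ := (Set.finite_range (fun x : P × P => dist x.1 x.2)).bddAbove
  obtain ⟨l, hl⟩ := pow_unbounded_of_one_lt (D / r) (by linarith : 1 < B)
  refine N.mem_family.2 ⟨l, p, ?_⟩
  ext q
  rw [mem_cluster]
  refine ⟨fun _ => ?_, fun _ => Finset.mem_univ q⟩
  by_contra hne
  have h1 := N.le_dist_anc l q p hne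
  have h2 : dist (N.anc l q) (N.anc l p) ≤ D := hD ⟨(N.anc l q, N.anc l p), rfl⟩
  rw [div_lt_iff₀ hr] at hl
  linarith

theorem scale_univ_le (hr : 0 < r) (hB : 8 ≤ B) (hcard : 2 ≤ Fintype.card P)
    {T : Finset (Sym2 P)} (hT : IsConnectedOn T) :
    N.scale Finset.univ ≤ B * totalWeight T := by
  obtain ⟨p, q, hpq⟩ := Fintype.one_lt_card_iff.1 hcard
  have : Nonempty P := ⟨p⟩
  have hU := N.univ_mem_family hr hB
  unfold scale
  rcases hl : N.level Finset.univ with _ | l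
  · have h1 := N.eq_cluster_level hU (Finset.mem_univ p)
    rw [hl, N.cluster_zero] at h1
    have h2 := Finset.mem_univ q
    rw [h1, Finset.mem_singleton] at h2
    exact (hpq h2.symm).elim
  · have h1 : N.cluster l p ≠ Finset.univ := by
      intro h
      have := N.level_cluster_le l p
      rw [h, hl] at this
      omega
    obtain ⟨x, hx⟩ : ∃ x, x ∉ N.cluster l p := by
      by_contra! h
      exact h1 (Finset.eq_univ_iff_forall.2 h)
    rw [mem_cluster] at hx
    have h2 := (N.le_dist_anc l x p hx).trans (dist_le_totalWeight hT _ _)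
    rw [pow_succ]
    nlinarith

theorem sum_scales_le_of_disjoint (A : Finset (Finset P)) (ℓ : Finset P → ℕ)
    (hℓ : ∀ u ∈ A, ∃ p, u = N.cluster (ℓ u) p) (hA : ∀ u ∈ A, u ≠ Finset.univ)
    (hdisj : ∀ u ∈ A, ∀ v ∈ A, u ≠ v → Disjoint u v) {T : Finset (Sym2 P)}
    (hT : IsConnectedOn T) : ∑ u ∈ A, r * B ^ ℓ u ≤ 8 * totalWeight T := by
  classical
  rcases A.eq_empty_or_nonempty with rfl | ⟨u₀, hu₀⟩
  · rw [Finset.sum_empty]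
    exact mul_nonneg (by norm_num) (Finset.sum_nonneg fun e _ => edgeWeight_nonneg e)
  obtain ⟨p₀, -⟩ := hℓ u₀ hu₀
  have : Nonempty P := ⟨p₀⟩
  choose! x hx using hℓ
  have h1 := sum_radius_le_totalWeight hT A hdisj (fun v => r * B ^ ℓ v / 4)
    (fun v => N.anc (ℓ v) (x v)) (fun v hv q hq => by
      rw [hx v hv, mem_cluster]
      exact N.anc_eq_of_dist_lt _ _ _ hq) (fun v hv => by
      by_contra! h
      exact hA v hv (Finset.eq_univ_iff_forall.2 h))
  rw [← Finset.sum_div] at h1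
  linarith

theorem sum_scales_le (hr : 0 < r) (hB : 8 ≤ B) (hcard : 2 ≤ Fintype.card P)
    (A : Finset (Finset P)) (ℓ : Finset P → ℕ)
    (hℓ : ∀ u ∈ A, ∃ p, u = N.cluster (ℓ u) p) (hA : ∀ u ∈ A, u ≠ Finset.univ) (J : ℕ)
    (hJ : Fintype.card P ≤ 2 ^ J) {T : Finset (Sym2 P)} (hT : IsConnectedOn T) :
    ∑ u ∈ A, r * B ^ ℓ u ≤ (8 * J + 2 * B) * totalWeight T := by
  classical
  have : Nonempty P := Fintype.card_pos_iff.1 (by omega)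
  have hU := N.univ_mem_family hr hB
  have hAF : A ⊆ N.family := by
    intro u hu
    obtain ⟨p, hp⟩ := hℓ u hu
    exact N.mem_family.2 ⟨_, p, hp⟩
  set top := N.level (Finset.univ : Finset P) with htop
  have hlt : ∀ u ∈ A, ℓ u < top := by
    intro u hu
    by_contra! hle
    obtain ⟨p, hp⟩ := hℓ u hu
    refine hA u hu (Finset.univ_subset_iff.1 ?_)
    rw [hp]
    conv_lhs => rw [N.eq_cluster_level hU (Finset.mem_univ p)]
    exact N.cluster_mono hle p
  have h1 : ∑ u ∈ A with top - 1 - ℓ u < J, r * B ^ ℓ u ≤ J * (8 * totalWeight T) := by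
    rw [← Finset.sum_fiberwise_of_maps_to (t := Finset.range J) (g := fun u => top - 1 - ℓ u)
      (fun u hu => Finset.mem_range.2 (Finset.mem_filter.1 hu).2)]
    have h2 : ∀ i ∈ Finset.range J, ∑ u ∈ A.filter (fun u => top - 1 - ℓ u < J) with
        top - 1 - ℓ u = i, r * B ^ ℓ u ≤ 8 * totalWeight T := by
      intro i _
      have hmem : ∀ u ∈ (A.filter (fun u => top - 1 - ℓ u < J)).filter
          (fun u => top - 1 - ℓ u = i), u ∈ A ∧ ℓ u = top - 1 - i := by
        intro u hu
        obtain ⟨hu, hui⟩ := Finset.mem_filter.1 hu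
        have hu := (Finset.mem_filter.1 hu).1
        have := hlt u hu
        exact ⟨hu, by omega⟩
      refine N.sum_scales_le_of_disjoint _ ℓ (fun u hu => hℓ u (hmem u hu).1)
        (fun u hu => hA u (hmem u hu).1) (fun u hu v hv huv => ?_) hT
      obtain ⟨p, hp⟩ := hℓ u (hmem u hu).1
      obtain ⟨q, hq⟩ := hℓ v (hmem v hv).1
      rw [(hmem u hu).2] at hp
      rw [(hmem v hv).2] at hq
      refine Finset.disjoint_left.2 fun x hxu hxv => huv ?_
      rw [hp] at hxu
      rw [hq] at hxv
      rw [hp, hq, ← N.cluster_eq_of_mem hxu, ← N.cluster_eq_of_mem hxv]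
    simpa using Finset.sum_le_sum h2
  have h2 : ∑ u ∈ A with ¬ top - 1 - ℓ u < J, r * B ^ ℓ u ≤ 2 * N.scale Finset.univ := by
    obtain ⟨n, hn⟩ : ∃ n : ℝ, n = (Fintype.card P : ℝ) := ⟨_, rfl⟩
    have hn0 : 0 < n := by
      rw [hn]
      exact_mod_cast (by omega : 0 < Fintype.card P)
    have hn2 : n ≤ 2 ^ J := by
      rw [hn]
      exact_mod_cast hJ
    have h3 : ∀ u ∈ A.filter (fun u => ¬ top - 1 - ℓ u < J),
        r * B ^ ℓ u ≤ N.scale Finset.univ / n := by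
      intro u hu
      obtain ⟨hu, huJ⟩ := Finset.mem_filter.1 hu
      have := hlt u hu
      rw [le_div_iff₀ hn0]
      have h4 : n ≤ B ^ J := hn2.trans (pow_le_pow_left₀ (by norm_num) (by linarith) J)
      have h5 : B ^ (ℓ u + J) ≤ B ^ top := pow_le_pow_right₀ (by linarith) (by omega)
      have h6 : 0 < r * B ^ ℓ u := by positivity
      calc r * B ^ ℓ u * n ≤ r * B ^ ℓ u * B ^ J := mul_le_mul_of_nonneg_left h4 h6.le
        _ = r * B ^ (ℓ u + J) := by rw [pow_add]; ring
        _ ≤ r * B ^ top := mul_le_mul_of_nonneg_left h5 hr.le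
    have h4 := Finset.sum_le_card_nsmul _ _ _ h3
    have h5 : ((A.filter (fun u => ¬ top - 1 - ℓ u < J)).card : ℝ) ≤ 2 * n := by
      have h6 : N.family.card ≤ 2 * (Finset.univ : Finset P).card :=
        N.laminar_family.card_le (fun v hv => N.nonempty_of_mem_family hv)
          fun v _ => Finset.subset_univ v
      have h7 := (Finset.card_le_card ((Finset.filter_subset
        (fun u => ¬ top - 1 - ℓ u < J) A).trans hAF)).trans h6
      rw [Finset.card_univ] at h7
      rw [hn]
      exact_mod_cast h7
    rw [nsmul_eq_mul] at h4
    have h6 : 0 ≤ N.scale Finset.univ / n := div_nonneg (N.scale_pos hr hB _).le hn0.le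
    calc _ ≤ _ := h4
      _ ≤ 2 * n * (N.scale Finset.univ / n) := mul_le_mul_of_nonneg_right h5 h6
      _ = 2 * N.scale Finset.univ := by field_simp
  rw [← Finset.sum_filter_add_sum_filter_not A (fun u => top - 1 - ℓ u < J)]
  have h3 := N.scale_univ_le hr hB hcard hT
  linarith

end NetTree

/-- The members of a laminar family can be represented by points of their own so that no point
represents more than two of them. -/
theorem Laminar.exists_points {α : Type*} [DecidableEq α] [Nonempty α] {F : Finset (Finset α)}
    (hF : Laminar F) (hne : ∀ v ∈ F, v.Nonempty) :
    ∃ f : Finset α → α, (∀ v ∈ F, f v ∈ v) ∧ ∀ p, (F.filter (fun v => f v = p)).card ≤ 2 := by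
  classical
  obtain ⟨g, hg, hginj⟩ := hF.exists_representatives
  choose! x hx using hne
  refine ⟨fun v => if 2 ≤ v.card then g v else x v, fun v hv => ?_, fun p => ?_⟩
  · dsimp only
    split_ifs with h
    · exact hg v hv h
    · exact hx v hv
  · have hsub : F.filter (fun v => (if 2 ≤ v.card then g v else x v) = p) ⊆
        insert {p} (F.filter (fun v => 2 ≤ v.card ∧ g v = p)) := by
      intro v hv
      obtain ⟨hvF, hv⟩ := Finset.mem_filter.1 hv
      split_ifs at hv with h
      · exact Finset.mem_insert_of_mem (Finset.mem_filter.2 ⟨hvF, h, hv⟩)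
      · refine Finset.mem_insert.2 (.inl ?_)
        have hpv := hx v hvF
        rw [hv] at hpv
        have h1 : v.card = 1 := by
          have := Finset.card_pos.2 ⟨p, hpv⟩
          omega
        obtain ⟨y, rfl⟩ := Finset.card_eq_one.1 h1
        rw [Finset.mem_singleton.1 hpv]
    have h1 : (F.filter (fun v => 2 ≤ v.card ∧ g v = p)).card ≤ 1 := by
      refine Finset.card_le_one.2 fun u hu v hv => ?_
      obtain ⟨hu, hu2, hup⟩ := Finset.mem_filter.1 hu
      obtain ⟨hv, hv2, hvp⟩ := Finset.mem_filter.1 hv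
      exact hginj u hu v hv hu2 hv2 (hup.trans hvp.symm)
    calc _ ≤ _ := Finset.card_le_card hsub
      _ ≤ _ := Finset.card_insert_le _ _
      _ ≤ 2 := by omega

namespace NetTree

variable {P : Type} [MetricSpace P] [Fintype P] {r B : ℝ} (N : NetTree P r B)

open Classical in
theorem card_children_le (hr : 0 < r) (hB : 8 ≤ B) {d : ℕ} (hd : DoublingDimLE P d) {i : ℕ}
    (hi : 14 * B ≤ 2 ^ i) {v : Finset P} (hv : v ∈ N.family) :
    (N.family.filter (fun u => u < v ∧ ∀ x ∈ N.family, u < x → v ≤ x)).card ≤ (2 ^ d) ^ i := by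
  obtain ⟨y, hy⟩ := N.nonempty_of_mem_family hv
  have hpt : ∀ u ∈ N.family.filter (fun u => u < v ∧ ∀ x ∈ N.family, u < x → v ≤ x),
      ∃ p ∈ v, u = N.cluster (N.level v - 1) p := by
    intro u hu
    obtain ⟨hu, huv, hmin⟩ := Finset.mem_filter.1 hu
    obtain ⟨p, hp⟩ := N.nonempty_of_mem_family hu
    have hlt := N.level_lt hu hv huv
    refine ⟨p, huv.le hp, ?_⟩
    have hsub : u ≤ N.cluster (N.level v - 1) p := by
      conv_lhs => rw [N.eq_cluster_level hu hp]
      exact N.cluster_mono (by omega) p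
    refine hsub.eq_or_lt.resolve_right fun hlt' => ?_
    have h1 := hmin _ (N.cluster_mem_family _ p) hlt'
    have h2 : N.cluster (N.level v - 1) p ≤ v := by
      conv_rhs => rw [N.eq_cluster_level hv (huv.le hp)]
      exact N.cluster_mono (by omega) p
    have h3 := N.level_cluster_le (N.level v - 1) p
    rw [h2.antisymm h1] at h3
    omega
  have : Nonempty P := ⟨y⟩
  by_cases h0 : N.level v = 0
  · rw [Finset.card_eq_zero.2]
    · exact Nat.zero_le _
    · refine Finset.filter_eq_empty_iff.2 fun u hu h => ?_
      have := N.level_lt hu hv h.1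
      omega
  obtain ⟨l, hl⟩ := Nat.exists_eq_succ_of_ne_zero h0
  rw [hl, Nat.succ_sub_one] at hpt
  choose! x hxv hx using hpt
  have hpos : 0 < r * B ^ l := by positivity
  have hscale : N.scale v = B * (r * B ^ l) := by
    rw [scale, hl, pow_succ]
    ring
  rw [← Finset.card_image_of_injOn (f := fun u => N.anc l (x u))]
  · refine hd.card_le i y (7 * N.scale v) (r * B ^ l) _ (fun z hz => ?_)
      (fun z hz w hw hzw => ?_) ?_
    · obtain ⟨u, hu, rfl⟩ := Finset.mem_image.1 hz
      have h1 := N.dist_anc_le l (x u)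
      have h2 := N.dist_le_of_mem hv (hxv u hu) hy
      have h3 := dist_triangle_left (N.anc l (x u)) y (x u)
      rw [hscale] at h2 ⊢
      nlinarith
    · obtain ⟨u, hu, rfl⟩ := Finset.mem_image.1 hz
      obtain ⟨u', hu', rfl⟩ := Finset.mem_image.1 hw
      exact N.le_dist_anc l _ _ hzw
    · rw [hscale]
      nlinarith
  · intro u hu u' hu' huu
    rw [hx u hu, hx u' hu']
    exact N.cluster_eq_of_mem (N.mem_cluster.2 huu)

/-- Two different clusters of the same level whose centres are close to each other. -/
def Cross (c : ℝ) (u v : Finset P) : Prop :=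
  u ≠ v ∧ ∃ l p q, u = N.cluster l p ∧ v = N.cluster l q ∧
    dist (N.anc l p) (N.anc l q) ≤ c * (r * B ^ l)

theorem lt_dist_anc_of_cluster_eq (hr : 0 < r) (hB : 8 ≤ B) {c : ℝ} (hc : 4 * (c + 4) < B)
    {l l' : ℕ} {p p' q : P} (h : N.cluster l p = N.cluster l' p') (hll : l < l')
    (hne : N.cluster l p ≠ N.cluster l q) :
    c * (r * B ^ l) < dist (N.anc l p) (N.anc l q) := by
  by_contra! hle
  have hpos : 0 < r * B ^ l := by positivity
  have hmem : p ∈ N.cluster l' p' := h ▸ N.self_mem_cluster l p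
  have h1 : N.cluster (l + 1) p ⊆ N.cluster l p := by
    rw [h, ← N.cluster_eq_of_mem hmem]
    exact N.cluster_mono hll p
  have h2 : N.anc (l + 1) p ∈ N.cluster (l + 1) p := by
    refine N.mem_cluster.2 (N.anc_eq_of_dist_lt _ _ _ ?_)
    rw [dist_self]
    positivity
  have h3 := N.dist_anc_le_of_mem (h1 h2)
  have h4 := N.dist_anc_le l q
  have h5 := dist_triangle4 q (N.anc l q) (N.anc l p) (N.anc (l + 1) p)
  rw [dist_comm (N.anc l q), dist_comm (N.anc l p) (N.anc (l + 1) p)] at h5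
  refine hne (N.cluster_eq_of_mem (h1 (N.mem_cluster.2
    (N.anc_eq_of_dist_lt (l + 1) p q ?_)))).symm
  rw [pow_succ]
  nlinarith

theorem exists_cross_level (hr : 0 < r) (hB : 8 ≤ B) {c : ℝ} (hc : 4 * (c + 4) < B) :
    ∃ ℓ : Finset P → ℕ, ∀ u v, N.Cross c u v → ∃ p q, u = N.cluster (ℓ u) p ∧
      v = N.cluster (ℓ u) q ∧ dist (N.anc (ℓ u) p) (N.anc (ℓ u) q) ≤ c * (r * B ^ ℓ u) := by
  have key : ∀ u, ∃ l, ∀ v, N.Cross c u v → ∃ p q, u = N.cluster l p ∧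
      v = N.cluster l q ∧ dist (N.anc l p) (N.anc l q) ≤ c * (r * B ^ l) := by
    intro u
    by_cases h : ∃ v, N.Cross c u v
    · obtain ⟨v, hne, l, p, q, hu, hv, hpq⟩ := h
      refine ⟨l, ?_⟩
      rintro v' ⟨hne', l', p', q', hu', hv', hpq'⟩
      rcases lt_trichotomy l l' with hl | rfl | hl
      · exact (hpq.not_gt (N.lt_dist_anc_of_cluster_eq hr hB hc (hu.symm.trans hu') hl
          (by rwa [← hu, ← hv]))).elim
      · exact ⟨p', q', hu', hv', hpq'⟩
      · exact (hpq'.not_gt (N.lt_dist_anc_of_cluster_eq hr hB hc (hu'.symm.trans hu) hl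
          (by rwa [← hu', ← hv']))).elim
    · exact ⟨0, fun v hv => (h ⟨v, hv⟩).elim⟩
  choose ℓ hℓ using key
  exact ⟨ℓ, hℓ⟩

theorem Cross.symm {c : ℝ} {u v : Finset P} (h : N.Cross c u v) : N.Cross c v u := by
  obtain ⟨hne, l, p, q, hu, hv, hpq⟩ := h
  exact ⟨hne.symm, l, q, p, hv, hu, by rwa [dist_comm]⟩

open Classical in
theorem card_cross_le (hr : 0 < r) (hB : 8 ≤ B) {c : ℝ} (hc : 4 * (c + 4) < B) {d : ℕ}
    (hd : DoublingDimLE P d) {i : ℕ} (hi : 14 * B ≤ 2 ^ i) (u : Finset P) :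
    (Finset.univ.filter (fun v => N.Cross c u v)).card ≤ (2 ^ d) ^ i := by
  obtain ⟨ℓ, hℓ⟩ := N.exists_cross_level hr hB hc
  rcases (Finset.univ.filter (fun v => N.Cross c u v)).eq_empty_or_nonempty with h0 | ⟨v₀, hv₀⟩
  · rw [h0, Finset.card_empty]
    exact Nat.zero_le _
  obtain ⟨p, q₀, hu, -, -⟩ := hℓ u v₀ (Finset.mem_filter.1 hv₀).2
  have hpt : ∀ v ∈ Finset.univ.filter (fun v => N.Cross c u v), ∃ q, v = N.cluster (ℓ u) q ∧
      dist (N.anc (ℓ u) q) (N.anc (ℓ u) p) ≤ c * (r * B ^ ℓ u) := by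
    intro v hv
    obtain ⟨p', q, hu', hv', hpq⟩ := hℓ u v (Finset.mem_filter.1 hv).2
    refine ⟨q, hv', ?_⟩
    have : p ∈ N.cluster (ℓ u) p' := by
      rw [← hu', hu]
      exact N.self_mem_cluster _ _
    rwa [N.mem_cluster.1 this, dist_comm]
  have : Nonempty P := ⟨p⟩
  choose! x hx hxp using hpt
  have hpos : 0 < r * B ^ ℓ u := by positivity
  rw [← Finset.card_image_of_injOn (f := fun v => N.anc (ℓ u) (x v))]
  · refine hd.card_le i (N.anc (ℓ u) p) ((c + 1) * (r * B ^ ℓ u)) (r * B ^ ℓ u) _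
      (fun z hz => ?_) (fun z hz w hw hzw => ?_) ?_
    · obtain ⟨v, hv, rfl⟩ := Finset.mem_image.1 hz
      have := hxp v hv
      linarith
    · obtain ⟨v, hv, rfl⟩ := Finset.mem_image.1 hz
      obtain ⟨w, hw, rfl⟩ := Finset.mem_image.1 hw
      exact N.le_dist_anc _ _ _ hzw
    · nlinarith
  · intro v hv w hw hvw
    rw [hx v hv, hx w hw]
    exact N.cluster_eq_of_mem (N.mem_cluster.2 hvw)

end NetTree

section ImageGraph

variable {P : Type} {V : Type*} (f : V → P) (Q : Finset (V × V))

open Classical in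
/-- The graph obtained from a set of links by placing their ends at points. -/
noncomputable def imageGraph : Finset (Sym2 P) :=
  (Q.image (fun e => s(f e.1, f e.2))).filter (fun e => ¬ e.IsDiag)

theorem mem_imageGraph {x : Sym2 P} :
    x ∈ imageGraph f Q ↔ (∃ e ∈ Q, s(f e.1, f e.2) = x) ∧ ¬ x.IsDiag := by
  classical
  simp only [imageGraph, Finset.mem_filter, Finset.mem_image]

theorem isGraphOn_imageGraph : IsGraphOn (imageGraph f Q) := fun _ he =>
  ((mem_imageGraph f Q).1 he).2

theorem card_imageGraph_le : (imageGraph f Q).card ≤ Q.card := by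
  classical
  exact (Finset.card_filter_le _ _).trans Finset.card_image_le

theorem eq_or_mem_imageGraph {Q : Finset (V × V)} {u v : V} (h : Joined Q u v) :
    f u = f v ∨ s(f u, f v) ∈ imageGraph f Q := by
  classical
  rcases eq_or_ne (f u) (f v) with he | hne
  · exact .inl he
  · refine .inr ((mem_imageGraph f Q).2 ⟨?_, by simpa using hne⟩)
    rcases h with h | h
    · exact ⟨_, h, rfl⟩
    · exact ⟨_, h, Sym2.eq_swap⟩

theorem totalWeight_imageGraph_le [MetricSpace P] :
    totalWeight (imageGraph f Q) ≤ ∑ e ∈ Q, dist (f e.1) (f e.2) := by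
  classical
  have h1 : imageGraph f Q ⊆ Q.biUnion (fun e => {s(f e.1, f e.2)}) := by
    intro x hx
    obtain ⟨e, he, rfl⟩ := ((mem_imageGraph f Q).1 hx).1
    exact Finset.mem_biUnion.2 ⟨e, he, Finset.mem_singleton_self _⟩
  calc totalWeight (imageGraph f Q)
      ≤ ∑ x ∈ Q.biUnion (fun e => {s(f e.1, f e.2)}), edgeWeight x :=
        Finset.sum_le_sum_of_subset_of_nonneg h1 fun x _ _ => edgeWeight_nonneg x
    _ ≤ ∑ e ∈ Q, ∑ x ∈ {s(f e.1, f e.2)}, edgeWeight x :=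
        sum_biUnion_le _ _ _ edgeWeight_nonneg
    _ = _ := by simp [edgeWeight]

theorem degree_imageGraph_le [DecidableEq V] [DecidableEq P] {F : Finset V}
    (hF : ∀ e ∈ Q, e.1 ∈ F ∧ e.2 ∈ F)
    {a m : ℕ} (ha : ∀ p, (F.filter (fun v => f v = p)).card ≤ a)
    (hm : ∀ v, (Q.filter (fun e => e.1 = v ∨ e.2 = v)).card ≤ m) (p : P) :
    degree (imageGraph f Q) p ≤ a * m := by
  classical
  have h1 : (imageGraph f Q).filter (fun e => p ∈ e) ⊆
      ((F.filter (fun v => f v = p)).biUnion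
        (fun v => Q.filter (fun e => e.1 = v ∨ e.2 = v))).image (fun e => s(f e.1, f e.2)) := by
    intro x hx
    obtain ⟨hx, hp⟩ := Finset.mem_filter.1 hx
    obtain ⟨e, he, rfl⟩ := ((mem_imageGraph f Q).1 hx).1
    refine Finset.mem_image.2 ⟨e, Finset.mem_biUnion.2 ?_, rfl⟩
    rcases Sym2.mem_iff.1 hp with hp | hp
    · exact ⟨e.1, Finset.mem_filter.2 ⟨(hF e he).1, hp.symm⟩, Finset.mem_filter.2 ⟨he, .inl rfl⟩⟩
    · exact ⟨e.2, Finset.mem_filter.2 ⟨(hF e he).2, hp.symm⟩, Finset.mem_filter.2 ⟨he, .inr rfl⟩⟩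
  calc degree (imageGraph f Q) p ≤ _ := by
        unfold degree
        convert Finset.card_le_card h1
    _ ≤ _ := Finset.card_image_le
    _ ≤ (F.filter (fun v => f v = p)).card * m :=
      Finset.card_biUnion_le_card_mul _ _ _ fun v _ => hm v
    _ ≤ a * m := Nat.mul_le_mul_right m (ha p)

end ImageGraph

theorem le_mul_mstWeight {P : Type} [MetricSpace P] [Fintype P] [Nonempty P] {w a : ℝ} (ha : 0 < a)
    (h : ∀ T : Finset (Sym2 P), IsConnectedOn T → w ≤ a * totalWeight T) :
    w ≤ a * mstWeight P := by
  have := le_mstWeight (P := P) (w := w / a) fun T hT => (div_le_iff₀' ha).2 (h T hT)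
  rwa [div_le_iff₀' ha] at this

namespace NetTree

variable {P : Type} [MetricSpace P] [Fintype P] {r B : ℝ} (N : NetTree P r B)

theorem sum_family_scale_le (hr : 0 < r) (hB : 8 ≤ B) (hcard : 2 ≤ Fintype.card P) {J : ℕ}
    (hJ : Fintype.card P ≤ 2 ^ J) :
    ∑ u ∈ N.family, N.scale u ≤ (8 * J + 3 * B) * mstWeight P := by
  classical
  have : Nonempty P := Fintype.card_pos_iff.1 (by omega)
  refine le_mul_mstWeight (by positivity) fun W hW => ?_
  rw [← Finset.sum_erase_add _ _ (N.univ_mem_family hr hB)]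
  have h1 := N.sum_scales_le hr hB hcard (N.family.erase Finset.univ) N.level
    (fun u hu => by
      have hu := Finset.mem_of_mem_erase hu
      obtain ⟨p, hp⟩ := N.nonempty_of_mem_family hu
      exact ⟨p, N.eq_cluster_level hu hp⟩)
    (fun u hu => Finset.ne_of_mem_erase hu) J hJ hW
  have h2 := N.scale_univ_le hr hB hcard hW
  unfold scale at h2 ⊢
  linarith

theorem sum_scale_le_of_disjoint (hr : 0 < r) (hB : 8 ≤ B) (hcard : 2 ≤ Fintype.card P)
    {A : Finset (Finset P)} (hA : A ⊆ N.family)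
    (hdisj : ∀ u ∈ A, ∀ v ∈ A, u ≠ v → Disjoint u v) :
    ∑ u ∈ A, N.scale u ≤ (8 + B) * mstWeight P := by
  classical
  have : Nonempty P := Fintype.card_pos_iff.1 (by omega)
  refine le_mul_mstWeight (by positivity) fun W hW => ?_
  have h1 := N.sum_scales_le_of_disjoint (A.erase Finset.univ) N.level
    (fun u hu => by
      have hu := hA (Finset.mem_of_mem_erase hu)
      obtain ⟨p, hp⟩ := N.nonempty_of_mem_family hu
      exact ⟨p, N.eq_cluster_level hu hp⟩)
    (fun u hu => Finset.ne_of_mem_erase hu)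
    (fun u hu v hv => hdisj u (Finset.mem_of_mem_erase hu) v (Finset.mem_of_mem_erase hv)) hW
  have h2 := N.scale_univ_le hr hB hcard hW
  have h3 : ∑ u ∈ A, N.scale u ≤
      ∑ u ∈ insert Finset.univ (A.erase Finset.univ), N.scale u :=
    Finset.sum_le_sum_of_subset_of_nonneg (Finset.insert_erase_subset _ _)
      fun u _ _ => (N.scale_pos hr hB u).le
  rw [Finset.sum_insert (Finset.notMem_erase _ _)] at h3
  unfold scale at h2 h3 ⊢
  linarith

open Classical in
/-- All pairs of close clusters. -/
noncomputable def crossPairs (c : ℝ) : Finset (Finset P × Finset P) :=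
  Finset.univ.filter (fun e => N.Cross c e.1 e.2)

theorem mem_crossPairs {c : ℝ} {e : Finset P × Finset P} :
    e ∈ N.crossPairs c ↔ N.Cross c e.1 e.2 := by
  simp [crossPairs]

theorem Cross.mem_family {c : ℝ} {u v : Finset P} (h : N.Cross c u v) : u ∈ N.family := by
  obtain ⟨-, l, p, q, rfl, -⟩ := h
  exact N.cluster_mem_family l p

theorem Cross.ne_univ {c : ℝ} {u v : Finset P} (h : N.Cross c u v) : u ≠ Finset.univ := by
  obtain ⟨hne, l, p, q, rfl, rfl, -⟩ := h
  intro h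
  exact hne (N.cluster_eq_of_mem (h ▸ Finset.mem_univ q)).symm

open Classical in
theorem card_filter_crossPairs_le (hr : 0 < r) (hB : 8 ≤ B) {c : ℝ} (hc : 4 * (c + 4) < B) {d : ℕ}
    (hd : DoublingDimLE P d) {i : ℕ} (hi : 14 * B ≤ 2 ^ i) (v : Finset P) :
    ((N.crossPairs c).filter (fun e => e.1 = v ∨ e.2 = v)).card ≤ 2 * (2 ^ d) ^ i := by
  have h1 := N.card_cross_le hr hB hc hd hi v
  have h2 : (N.crossPairs c).filter (fun e => e.1 = v ∨ e.2 = v) ⊆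
      (Finset.univ.filter (fun u => N.Cross c v u)).image (fun u => (v, u)) ∪
      (Finset.univ.filter (fun u => N.Cross c v u)).image (fun u => (u, v)) := by
    rintro ⟨x, y⟩ he
    obtain ⟨he', rfl | rfl⟩ := Finset.mem_filter.1 he
    · exact Finset.mem_union_left _ (Finset.mem_image.2
        ⟨y, Finset.mem_filter.2 ⟨Finset.mem_univ _, N.mem_crossPairs.1 he'⟩, rfl⟩)
    · exact Finset.mem_union_right _ (Finset.mem_image.2
        ⟨x, Finset.mem_filter.2 ⟨Finset.mem_univ _, (N.mem_crossPairs.1 he').symm⟩, rfl⟩)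
  calc _ ≤ _ := Finset.card_le_card h2
    _ ≤ _ := Finset.card_union_le _ _
    _ ≤ _ := Nat.add_le_add Finset.card_image_le Finset.card_image_le
    _ ≤ _ := by omega

theorem card_crossPairs_le (hr : 0 < r) (hB : 8 ≤ B) {c : ℝ} (hc : 4 * (c + 4) < B) {d : ℕ}
    (hd : DoublingDimLE P d) {i : ℕ} (hi : 14 * B ≤ 2 ^ i) :
    (N.crossPairs c).card ≤ N.family.card * (2 ^ d) ^ i := by
  classical
  have h1 : N.crossPairs c ⊆ N.family.biUnion
      (fun u => (Finset.univ.filter (fun v => N.Cross c u v)).image (fun v => (u, v))) := by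
    rintro ⟨u, v⟩ he
    rw [mem_crossPairs] at he
    exact Finset.mem_biUnion.2 ⟨u, he.mem_family, Finset.mem_image.2
      ⟨v, Finset.mem_filter.2 ⟨Finset.mem_univ _, he⟩, rfl⟩⟩
  exact (Finset.card_le_card h1).trans (Finset.card_biUnion_le_card_mul _ _ _ fun u _ =>
    Finset.card_image_le.trans (N.card_cross_le hr hB hc hd hi u))

theorem sum_crossPairs_le (hr : 0 < r) (hB : 8 ≤ B) (hcard : 2 ≤ Fintype.card P) {c : ℝ}
    (hc0 : 0 ≤ c) (hc : 4 * (c + 4) < B) {d : ℕ} (hd : DoublingDimLE P d) {i : ℕ}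
    (hi : 14 * B ≤ 2 ^ i) {J : ℕ} (hJ : Fintype.card P ≤ 2 ^ J) (f : Finset P → P)
    (hf : ∀ v ∈ N.family, f v ∈ v) :
    ∑ e ∈ N.crossPairs c, dist (f e.1) (f e.2) ≤
      (2 ^ d) ^ i * (c + 4) * ((8 * J + 2 * B) * mstWeight P) := by
  classical
  have : Nonempty P := Fintype.card_pos_iff.1 (by omega)
  obtain ⟨ℓ, hℓ⟩ := N.exists_cross_level hr hB hc
  set A := (N.crossPairs c).image Prod.fst with hA
  have hpos : ∀ u, 0 < r * B ^ ℓ u := fun u => by positivity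
  have hAX : ∀ u ∈ A, ∃ v, N.Cross c u v := by
    intro u hu
    obtain ⟨e, he, rfl⟩ := Finset.mem_image.1 hu
    exact ⟨e.2, N.mem_crossPairs.1 he⟩
  have h0 : ∑ u ∈ A, r * B ^ ℓ u ≤ (8 * J + 2 * B) * mstWeight P := by
    refine le_mul_mstWeight (by positivity) fun W hW =>
      N.sum_scales_le hr hB hcard A ℓ (fun u hu => ?_) (fun u hu => ?_) J hJ hW
    · obtain ⟨v, hv⟩ := hAX u hu
      obtain ⟨p, q, hp, -⟩ := hℓ u v hv
      exact ⟨p, hp⟩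
    · obtain ⟨v, hv⟩ := hAX u hu
      exact hv.ne_univ
  have h1 : ∀ e ∈ N.crossPairs c, dist (f e.1) (f e.2) ≤ (c + 4) * (r * B ^ ℓ e.1) := by
    intro e he
    rw [mem_crossPairs] at he
    obtain ⟨p, q, hp, hq, hpq⟩ := hℓ _ _ he
    have h2 := hf _ he.mem_family
    have h3 := hf _ he.symm.mem_family
    generalize f e.1 = x at h2 ⊢
    generalize f e.2 = y at h3 ⊢
    rw [hp] at h2
    rw [hq] at h3
    have h4 := N.dist_anc_le_of_mem h2
    have h5 := N.dist_anc_le_of_mem h3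
    have h6 := dist_triangle4 x (N.anc (ℓ e.1) p) (N.anc (ℓ e.1) q) y
    rw [dist_comm (N.anc (ℓ e.1) q) y] at h6
    linarith
  have h2 : N.crossPairs c ⊆ A.biUnion
      (fun u => (Finset.univ.filter (fun v => N.Cross c u v)).image (fun v => (u, v))) := by
    rintro ⟨u, v⟩ he
    exact Finset.mem_biUnion.2 ⟨u, Finset.mem_image_of_mem _ he, Finset.mem_image.2
      ⟨v, Finset.mem_filter.2 ⟨Finset.mem_univ _, N.mem_crossPairs.1 he⟩, rfl⟩⟩
  have h3 : ∀ e : Finset P × Finset P, 0 ≤ (c + 4) * (r * B ^ ℓ e.1) := fun e =>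
    mul_nonneg (by linarith) (hpos _).le
  have h4 : ∀ u ∈ A, ∑ e ∈ (Finset.univ.filter (fun v => N.Cross c u v)).image (fun v => (u, v)),
      (c + 4) * (r * B ^ ℓ e.1) ≤ (2 ^ d) ^ i * ((c + 4) * (r * B ^ ℓ u)) := by
    intro u _
    rw [Finset.sum_image (fun v _ w _ h => (Prod.mk.inj h).2)]
    dsimp only
    rw [Finset.sum_const, nsmul_eq_mul]
    refine mul_le_mul_of_nonneg_right ?_ (h3 (u, u))
    exact_mod_cast N.card_cross_le hr hB hc hd hi u
  calc _ ≤ ∑ e ∈ N.crossPairs c, (c + 4) * (r * B ^ ℓ e.1) := Finset.sum_le_sum h1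
    _ ≤ _ := Finset.sum_le_sum_of_subset_of_nonneg h2 fun e _ _ => h3 e
    _ ≤ _ := sum_biUnion_le _ _ _ h3
    _ ≤ ∑ u ∈ A, (2 ^ d) ^ i * ((c + 4) * (r * B ^ ℓ u)) := Finset.sum_le_sum h4
    _ = (2 ^ d) ^ i * (c + 4) * ∑ u ∈ A, r * B ^ ℓ u := by
      rw [Finset.mul_sum]
      exact Finset.sum_congr rfl fun u _ => by ring
    _ ≤ _ := mul_le_mul_of_nonneg_left h0 (by positivity)

theorem weight_le {B D J w c β S E X : ℝ} (hD : 0 ≤ D) (hB : 8 ≤ B) (hJ : 1 ≤ J) (hw : 0 ≤ w)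
    (hβ : 0 ≤ β) (hc : c + 4 ≤ B) (hS : S ≤ (8 * J + 3 * B) * w)
    (hE : E ≤ (D + 1) * S + 66 * (β * ((8 + B) * w)))
    (hX : X ≤ D * (c + 4) * ((8 * J + 2 * B) * w)) :
    4 * E + X ≤ 1000 * (D + 1) * B ^ 2 * (J + β) * w := by
  have hBB : B ≤ B ^ 2 := by nlinarith
  have h1 : (D + 1) * S ≤ (D + 1) * (4 * B ^ 2 * J * w) := by
    refine mul_le_mul_of_nonneg_left (hS.trans (mul_le_mul_of_nonneg_right ?_ hw)) (by linarith)
    have h2 : 8 * J + 3 * B ≤ 4 * (B * J) := by nlinarith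
    have h3 : B * J ≤ B ^ 2 * J := mul_le_mul_of_nonneg_right hBB (by linarith)
    linarith
  have h2 : D * (c + 4) * ((8 * J + 2 * B) * w) ≤ D * B * (4 * B * J * w) :=
    mul_le_mul (mul_le_mul_of_nonneg_left hc hD)
      (mul_le_mul_of_nonneg_right (by nlinarith) hw) (by positivity) (by positivity)
  have h3 : β * ((8 + B) * w) ≤ 2 * (D + 1) * B ^ 2 * β * w := by
    have h4 : 8 + B ≤ 2 * (D + 1) * B ^ 2 := by nlinarith [mul_nonneg hD (sq_nonneg B)]
    have h5 : 0 ≤ β * w := mul_nonneg hβ hw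
    nlinarith [mul_le_mul_of_nonneg_right h4 h5]
  have h4 : 0 ≤ B ^ 2 * J * w := by positivity
  have h5 : 0 ≤ D * (B ^ 2 * J * w) := by positivity
  have h6 : 0 ≤ (D + 1) * B ^ 2 * β * w := by positivity
  have h7 : 1000 * (D + 1) * B ^ 2 * (J + β) * w = 1000 * (D * (B ^ 2 * J * w)) +
    1000 * (B ^ 2 * J * w) + 1000 * ((D + 1) * B ^ 2 * β * w) := by ring
  have h8 : D * B * (4 * B * J * w) = 4 * (D * (B ^ 2 * J * w)) := by ring
  have h9 : (D + 1) * (4 * B ^ 2 * J * w) = 4 * (D * (B ^ 2 * J * w)) + 4 * (B ^ 2 * J * w) := by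
    ring
  linarith

/-- The graph of one hierarchy: it serves all pairs at distance a suitable multiple of one of the
scales. -/
theorem exists_graph (N : NetTree P r B) (hr : 0 < r) (hB : 8 ≤ B)
    (hcard : 2 ≤ Fintype.card P) {c : ℝ} (hc0 : 0 ≤ c) (hc : 4 * (c + 4) < B) {d : ℕ}
    (hd : DoublingDimLE P d) {i D : ℕ} (hi : 14 * B ≤ 2 ^ i) (hD : D = (2 ^ d) ^ i) {J : ℕ} (hJ : Fintype.card P ≤ 2 ^ J)
    {b : ℕ} (hb : 2 ≤ b) {T : ℕ}
    (hT : Fintype.card P < b ^ T) {k : ℕ} (hk : 2 * b ≤ growth k 1) :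
    ∃ H : Finset (Sym2 P), IsGraphOn H ∧ H.card ≤ 2 * (35 + D) * Fintype.card P ∧
      (∀ p, degree H p ≤ 2 * (71 * b + 3 * D + 1)) ∧
      totalWeight H ≤ 1000 * (D + 1) * B ^ 2 * (J + b * T) * mstWeight P ∧
      ∀ l p q, dist p q + 4 * (r * B ^ l) ≤ c * (r * B ^ l) →
        Reach (fun x y => x = y ∨ s(x, y) ∈ H) dist (2 * (7 * T + 3 * k) + 1)
          (dist p q + 112 * (r * B ^ l)) p q := by
  classical
  have : Nonempty P := Fintype.card_pos_iff.1 (by omega)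
  have hmst : 0 ≤ mstWeight P := le_mstWeight fun W _ =>
    Finset.sum_nonneg fun e _ => edgeWeight_nonneg e
  obtain ⟨f, hf, hf2⟩ :=
    N.laminar_family.exists_points fun v hv => N.nonempty_of_mem_family hv
  obtain ⟨E, hEF, hEcard, hEw, hEdeg, hEwalk⟩ := N.laminar_family.exists_shortcuts
    (fun v hv => N.nonempty_of_mem_family hv) N.scale (fun v => (N.scale_pos hr hB v).le)
    (fun u hu v hv => N.two_mul_scale_le hr hB hu hv) D
    (fun v hv => by
      rw [hD]
      convert N.card_children_le hr hB hd hi hv) ((8 + B) * mstWeight P)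
    (fun A hA hdisj => N.sum_scale_le_of_disjoint hr hB hcard hA hdisj) hb T hT k hk
  have hEdist : ∀ e ∈ E, dist (f e.1) (f e.2) ≤ 4 * N.scale e.2 := fun e he =>
    N.dist_le_of_mem (hEF e he).2.1 ((hEF e he).2.2.le (hf _ (hEF e he).1)) (hf _ (hEF e he).2.1)
  have hF : N.family.card ≤ 2 * Fintype.card P :=
    N.laminar_family.card_le (fun v hv => N.nonempty_of_mem_family hv)
      fun v _ => Finset.subset_univ v
  refine ⟨imageGraph f (E ∪ N.crossPairs c), isGraphOn_imageGraph _ _, ?_, ?_, ?_, ?_⟩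
  · have h1 := N.card_crossPairs_le hr hB hc hd hi
    rw [← hD] at h1
    calc _ ≤ _ := card_imageGraph_le _ _
      _ ≤ _ := Finset.card_union_le _ _
      _ ≤ 35 * N.family.card + N.family.card * D := Nat.add_le_add hEcard h1
      _ = (35 + D) * N.family.card := by ring
      _ ≤ (35 + D) * (2 * Fintype.card P) := Nat.mul_le_mul_left _ hF
      _ = _ := by ring
  · refine degree_imageGraph_le f _ (F := N.family) (fun e he => ?_) hf2 (fun v => ?_)
    · rcases Finset.mem_union.1 he with he | he
      · exact ⟨(hEF e he).1, (hEF e he).2.1⟩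
      · rw [mem_crossPairs] at he
        exact ⟨he.mem_family, he.symm.mem_family⟩
    · have h1 := hEdeg v
      have h2 := N.card_filter_crossPairs_le hr hB hc hd hi v
      rw [← hD] at h2
      rw [Finset.filter_union]
      refine (Finset.card_union_le _ _).trans ?_
      have h3 : (E.filter (fun e => e.1 = v ∨ e.2 = v)).card ≤ 71 * b + D + 1 := by
        convert h1
      have h4 : ((N.crossPairs c).filter (fun e => e.1 = v ∨ e.2 = v)).card ≤ 2 * D := by
        convert h2
      omega
  · have hJ1 : (1 : ℝ) ≤ J := by
      rcases J with _ | J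
      · omega
      · push_cast
        linarith [Nat.cast_nonneg (α := ℝ) J]
    have h1 := N.sum_family_scale_le hr hB hcard hJ
    have h2 := N.sum_crossPairs_le hr hB hcard hc0 hc hd hi hJ f hf
    have h3 : ∑ e ∈ E, dist (f e.1) (f e.2) ≤ 4 * ∑ e ∈ E, N.scale e.2 := by
      rw [Finset.mul_sum]
      exact Finset.sum_le_sum hEdist
    have h4 : ∑ e ∈ E ∪ N.crossPairs c, dist (f e.1) (f e.2) ≤
        ∑ e ∈ E, dist (f e.1) (f e.2) + ∑ e ∈ N.crossPairs c, dist (f e.1) (f e.2) := by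
      rw [← Finset.sum_union_inter]
      exact le_add_of_nonneg_right (Finset.sum_nonneg fun _ _ => dist_nonneg)
    have h5 := totalWeight_imageGraph_le f (E ∪ N.crossPairs c)
    have hDR : ((2 : ℝ) ^ d) ^ i = D := by rw [hD]; push_cast; rfl
    rw [hDR] at h2
    have h6 := weight_le (Nat.cast_nonneg D) hB hJ1 hmst
      (by positivity : (0 : ℝ) ≤ b * T) (by linarith : c + 4 ≤ B) h1
      (hEw.trans_eq (by ring)) h2
    linarith
  · intro l p q hpq
    have hrl : 0 < r * B ^ l := by positivity
    have hscale : ∀ x, N.scale (N.cluster l x) ≤ r * B ^ l := fun x =>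
      mul_le_mul_of_nonneg_left (pow_le_pow_right₀ (by linarith) (N.level_cluster_le l x)) hr.le
    have hwalk : ∀ x, Reach (fun x y => x = y ∨ s(x, y) ∈ imageGraph f (E ∪ N.crossPairs c)) dist
        (7 * T + 3 * k) (52 * (r * B ^ l)) x (f (N.cluster l x)) := by
      intro x
      have h1 : f (N.cluster 0 x) = x := by
        have := hf _ (N.cluster_mem_family 0 x)
        rw [N.cluster_zero] at this ⊢
        exact Finset.mem_singleton.1 this
      have h2 := Reach.map (A' := fun x y => x = y ∨ s(x, y) ∈ imageGraph f (E ∪ N.crossPairs c))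
        (c' := dist) (K := 4) (by norm_num) f
        (hEwalk _ (N.cluster_mem_family 0 x) _ (N.cluster_mem_family l x)
          (N.cluster_mono (Nat.zero_le l) x))
        (fun u v h => eq_or_mem_imageGraph f (h.imp (Finset.mem_union_left _)
          (Finset.mem_union_left _)))
        (fun u v h => by
          rcases h with h | h
          · exact (hEdist _ h).trans (mul_le_mul_of_nonneg_left (le_max_right _ _) (by norm_num))
          · rw [dist_comm]
            exact (hEdist _ h).trans (mul_le_mul_of_nonneg_left (le_max_left _ _) (by norm_num)))
      rw [h1] at h2
      exact h2.mono le_rfl (by linarith [hscale x])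
    have hback := (hwalk q).symm (fun u v h => h.imp Eq.symm (fun h => by rwa [Sym2.eq_swap]))
      dist_comm
    have hmid : Reach (fun x y => x = y ∨ s(x, y) ∈ imageGraph f (E ∪ N.crossPairs c)) dist
        1 (dist p q + 8 * (r * B ^ l)) (f (N.cluster l p)) (f (N.cluster l q)) := by
      have h1 := N.dist_le_of_mem (N.cluster_mem_family l p) (hf _ (N.cluster_mem_family l p))
        (N.self_mem_cluster l p)
      have h2 := N.dist_le_of_mem (N.cluster_mem_family l q) (N.self_mem_cluster l q)
        (hf _ (N.cluster_mem_family l q))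
      have h3 := dist_triangle4 (f (N.cluster l p)) p q (f (N.cluster l q))
      refine .single ?_ (by linarith [hscale p, hscale q])
      by_cases hne : N.cluster l p = N.cluster l q
      · exact .inl (by rw [hne])
      refine eq_or_mem_imageGraph f (.inl (Finset.mem_union_right _ (N.mem_crossPairs.2
        ⟨hne, l, p, q, rfl, rfl, ?_⟩)))
      have h4 := N.dist_anc_le l p
      have h5 := N.dist_anc_le l q
      have h6 := dist_triangle4 (N.anc l p) p q (N.anc l q)
      rw [dist_comm (N.anc l p) p] at h6
      linarith
    exact (((hwalk p).trans hmid).trans hback).mono (by omega) (by linarith)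

end NetTree

theorem Reach.exists_path {P : Type} [MetricSpace P] {H : Finset (Sym2 P)} {k : ℕ} {L : ℝ}
    {p q : P} (h : Reach (fun x y => x = y ∨ s(x, y) ∈ H) dist k L p q) :
    ∃ k' ≤ k, ∃ x : Fin (k' + 1) → P, x 0 = p ∧ x (Fin.last k') = q ∧
      (∀ i : Fin k', s(x i.castSucc, x i.succ) ∈ H) ∧
      ∑ i : Fin k', dist (x i.castSucc) (x i.succ) ≤ L := by
  induction h with
  | @refl k L u h0 =>
    exact ⟨0, Nat.zero_le _, fun _ => u, rfl, rfl, fun i => i.elim0, by simpa using h0⟩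
  | @step k L L' u w v hA _ hL ih =>
    obtain ⟨k', hk, x, hx0, hxl, hxH, hxL⟩ := ih
    rcases hA with rfl | hA
    · rw [dist_self, zero_add] at hL
      exact ⟨k', by omega, x, hx0, hxl, hxH, hxL.trans hL⟩
    · refine ⟨k' + 1, by omega, Fin.cons u x, rfl, ?_, fun i => ?_, ?_⟩
      · rw [← Fin.succ_last, Fin.cons_succ, hxl]
      · refine Fin.cases ?_ (fun i => ?_) i
        · rw [Fin.castSucc_zero, Fin.cons_zero, Fin.cons_succ, hx0]
          exact hA
        · rw [← Fin.succ_castSucc, Fin.cons_succ, Fin.cons_succ]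
          exact hxH i
      · rw [Fin.sum_univ_succ]
        simp only [Fin.castSucc_zero, Fin.cons_zero, Fin.cons_succ, hx0, ← Fin.succ_castSucc]
        linarith

theorem exists_pos_le_dist (P : Type) [MetricSpace P] [Fintype P] (hcard : 2 ≤ Fintype.card P) :
    ∃ μ : ℝ, 0 < μ ∧ ∀ p q : P, p ≠ q → μ ≤ dist p q := by
  classical
  obtain ⟨p, q, hpq⟩ := Fintype.one_lt_card_iff.1 hcard
  obtain ⟨e, he, hmin⟩ := (Finset.univ : Finset P).offDiag.exists_min_image
    (fun e => dist e.1 e.2) ⟨(p, q), by simpa using hpq⟩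
  refine ⟨dist e.1 e.2, dist_pos.2 (by simpa using he), fun x y hxy => ?_⟩
  exact hmin (x, y) (by simpa using hxy)

theorem exists_scale {κ : ℕ} (hκ : 0 < κ) {δ x : ℝ} (hδ : 0 < δ) (hx : δ ≤ x) :
    ∃ s < κ, ∃ l, δ * 2 ^ s * (2 ^ κ) ^ l ≤ x ∧ x ≤ 2 * (δ * 2 ^ s * (2 ^ κ) ^ l) := by
  obtain ⟨j, hj, hj'⟩ := exists_nat_pow_near ((one_le_div hδ).2 hx) (one_lt_two : (1 : ℝ) < 2)
  rw [le_div_iff₀ hδ] at hj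
  rw [div_lt_iff₀ hδ, pow_succ] at hj'
  have h1 : δ * 2 ^ (j % κ) * (2 ^ κ) ^ (j / κ) = 2 ^ j * δ := by
    rw [mul_assoc, ← pow_mul, ← pow_add, Nat.mod_add_div, mul_comm]
  refine ⟨j % κ, Nat.mod_lt _ hκ, j / κ, ?_, ?_⟩
  · rwa [h1]
  · rw [h1]
    linarith

/-- The spanner in terms of a branching parameter. -/
theorem exists_spanner (d : ℕ) {ε : ℝ} (hε : 0 < ε) :
    ∃ C : ℝ, 0 < C ∧ ∀ (P : Type) [MetricSpace P] [Fintype P], 2 ≤ Fintype.card P →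
      DoublingDimLE P d → ∀ b T k J : ℕ, 2 ≤ b → Fintype.card P < b ^ T → 2 * b ≤ growth k 1 →
      Fintype.card P ≤ 2 ^ J → ∃ H : Finset (Sym2 P), IsGraphOn H ∧
        (H.card : ℝ) ≤ C * Fintype.card P ∧ (∀ p, (degree H p : ℝ) ≤ C * b) ∧
        totalWeight H ≤ C * (J + b * T) * mstWeight P ∧
        ∀ p q, ∃ k' ≤ 2 * (7 * T + 3 * k) + 1, IsSpannerPath H (1 + ε) p q k' := by
  classical
  obtain ⟨m, hm⟩ : ∃ m : ℕ, m = ⌈112 / ε⌉₊ + 1 := ⟨_, rfl⟩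
  have hm1 : (1 : ℝ) ≤ m := by
    rw [hm]
    push_cast
    linarith [Nat.cast_nonneg (α := ℝ) ⌈112 / ε⌉₊]
  have hmε : 112 ≤ ε * m := by
    have h1 := Nat.le_ceil (112 / ε)
    rw [div_le_iff₀ hε] at h1
    rw [hm]
    push_cast
    linarith
  obtain ⟨κ, hκ⟩ : ∃ κ : ℕ, κ = 4 * (2 * m + 8) := ⟨_, rfl⟩
  obtain ⟨B, hBdef⟩ : ∃ B : ℝ, B = 2 ^ κ := ⟨_, rfl⟩
  have hB8 : 8 ≤ B := by
    rw [hBdef]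
    calc (8 : ℝ) = 2 ^ 3 := by norm_num
      _ ≤ 2 ^ κ := pow_le_pow_right₀ one_le_two (by omega)
  have hBκ : 4 * ((2 * m + 4 : ℝ) + 4) < B := by
    have : κ < 2 ^ κ := Nat.lt_two_pow_self
    have h1 : (κ : ℝ) < B := by
      rw [hBdef]
      exact_mod_cast this
    rw [hκ] at h1
    push_cast at h1
    linarith
  obtain ⟨D, hD⟩ : ∃ D : ℕ, D = (2 ^ d) ^ (κ + 4) := ⟨_, rfl⟩
  have hi : 14 * B ≤ 2 ^ (κ + 4) := by
    rw [pow_add, ← hBdef]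
    linarith
  have hκ0 : 0 < κ := by omega
  refine ⟨1000 * κ * (D + 1) * B ^ 2, by positivity, fun P _ _ hcard hd b T k J hb hT hk hJ => ?_⟩
  obtain ⟨μ, hμ, hmin⟩ := exists_pos_le_dist P hcard
  obtain ⟨δ, hδ⟩ : ∃ δ : ℝ, δ = μ / (m * B) := ⟨_, rfl⟩
  have hδ0 : 0 < δ := by
    rw [hδ]
    positivity
  have hδμ : δ * (m * B) = μ := by
    rw [hδ]
    field_simp
  have hgraph : ∀ s ∈ Finset.range κ, ∃ H : Finset (Sym2 P), IsGraphOn H ∧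
      H.card ≤ 2 * (35 + D) * Fintype.card P ∧
      (∀ p, degree H p ≤ 2 * (71 * b + 3 * D + 1)) ∧
      totalWeight H ≤ 1000 * (D + 1) * B ^ 2 * (J + b * T) * mstWeight P ∧
      ∀ l p q, dist p q + 4 * (δ * 2 ^ s * B ^ l) ≤ (2 * m + 4) * (δ * 2 ^ s * B ^ l) →
        Reach (fun x y => x = y ∨ s(x, y) ∈ H) dist (2 * (7 * T + 3 * k) + 1)
          (dist p q + 112 * (δ * 2 ^ s * B ^ l)) p q := by
    intro s hs
    have hr : 0 < δ * 2 ^ s := by positivity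
    obtain ⟨N⟩ := exists_netTree (P := P) hr hB8 fun p q hpq => by
      refine le_trans ?_ (hmin p q hpq)
      have h1 : (2 : ℝ) ^ s ≤ B := by
        rw [hBdef]
        exact pow_le_pow_right₀ one_le_two (Finset.mem_range.1 hs).le
      rw [← hδμ]
      exact mul_le_mul_of_nonneg_left (by nlinarith) hδ0.le
    exact N.exists_graph hr hB8 hcard (by positivity) hBκ hd hi hD hJ hb hT hk
  choose! G hG hGcard hGdeg hGw hGwalk using hgraph
  have hb2 : (2 : ℝ) ≤ b := by exact_mod_cast hb
  have hD0 : (0 : ℝ) ≤ D := Nat.cast_nonneg D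
  have hκR : (0 : ℝ) < κ := by exact_mod_cast hκ0
  have hB1 : 1 ≤ B ^ 2 := by nlinarith
  refine ⟨(Finset.range κ).biUnion G, fun e he => ?_, ?_, fun p => ?_, ?_, fun p q => ?_⟩
  · obtain ⟨s, hs, he⟩ := Finset.mem_biUnion.1 he
    exact hG s hs e he
  · have h1 := Finset.card_biUnion_le_card_mul _ _ _ hGcard
    rw [Finset.card_range] at h1
    have h2 : (((Finset.range κ).biUnion G).card : ℝ) ≤
        κ * (2 * (35 + D) * Fintype.card P) := by exact_mod_cast h1
    refine h2.trans ?_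
    have h3 : (0 : ℝ) ≤ κ * Fintype.card P := by positivity
    have h4 : 2 * (35 + (D : ℝ)) ≤ 1000 * (D + 1) * B ^ 2 := by nlinarith
    nlinarith [mul_le_mul_of_nonneg_left h4 h3]
  · have h1 : degree ((Finset.range κ).biUnion G) p ≤ κ * (2 * (71 * b + 3 * D + 1)) := by
      have h2 := Finset.card_biUnion_le_card_mul (Finset.range κ)
        (fun s => (G s).filter (fun e => p ∈ e)) _ (fun s hs => hGdeg s hs p)
      rw [Finset.card_range, ← Finset.filter_biUnion] at h2
      exact h2
    have h2 : (degree ((Finset.range κ).biUnion G) p : ℝ) ≤ κ * (2 * (71 * b + 3 * D + 1)) := by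
      exact_mod_cast h1
    refine h2.trans ?_
    have h3 : 2 * (71 * (b : ℝ) + 3 * D + 1) ≤ 1000 * ((D + 1) * b) := by nlinarith
    have h4 : ((D : ℝ) + 1) * b ≤ (D + 1) * b * B ^ 2 :=
      le_mul_of_one_le_right (by positivity) hB1
    nlinarith
  · have h1 : totalWeight ((Finset.range κ).biUnion G) ≤ ∑ s ∈ Finset.range κ, totalWeight (G s) :=
      sum_biUnion_le _ _ _ edgeWeight_nonneg
    have h2 := Finset.sum_le_sum hGw
    rw [Finset.sum_const, Finset.card_range, nsmul_eq_mul] at h2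
    linarith
  · by_cases hpq : p = q
    · subst hpq
      exact ⟨0, Nat.zero_le _, fun _ => p, rfl, rfl, fun i => i.elim0, by simp⟩
    have h1 : m * δ ≤ dist p q := by
      refine le_trans ?_ (hmin p q hpq)
      rw [← hδμ]
      have : 0 < m * δ := by positivity
      nlinarith
    obtain ⟨s, hs, l, h2, h3⟩ := exists_scale hκ0 (by positivity : 0 < m * δ) h1
    rw [← hBdef] at h2 h3
    have h4 : m * δ * 2 ^ s * B ^ l = m * (δ * 2 ^ s * B ^ l) := by ring
    rw [h4] at h2 h3
    have hpos : 0 < δ * 2 ^ s * B ^ l := by positivity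
    have hR := hGwalk s (Finset.mem_range.2 hs) l p q (by linarith)
    obtain ⟨k', hk', x, hx0, hxl, hxH, hxL⟩ := hR.exists_path
    refine ⟨k', hk', x, hx0, hxl, fun i => Finset.mem_biUnion.2
      ⟨s, Finset.mem_range.2 hs, hxH i⟩, hxL.trans ?_⟩
    have h5 := mul_le_mul_of_nonneg_right hmε hpos.le
    have h6 := mul_le_mul_of_nonneg_left h2 hε.le
    linarith

theorem invAck_spec (x : ℝ) : 1 ≤ invAck x ∧ x ≤ ack (invAck x) (invAck x) := by
  have hne : {k : ℕ | 1 ≤ k ∧ x ≤ ack k k}.Nonempty := by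
    refine ⟨⌈x⌉₊ + 1, Nat.le_add_left _ _, (Nat.le_ceil x).trans ?_⟩
    exact_mod_cast (Nat.le_succ _).trans (lt_ack_left (⌈x⌉₊ + 1) (⌈x⌉₊ + 1)).le
  exact Nat.sInf_mem hne

theorem two_mul_le_growth {b : ℕ} {ρ : ℝ} (hb : b ≤ ρ) : 2 * b ≤ growth (invAck ρ + 2) 1 := by
  set a := invAck ρ with ha
  have h1 : b ≤ ack a a := by exact_mod_cast hb.trans (invAck_spec ρ).2
  have h2 : ack a a ≤ ack (a + 2) 0 := by
    rw [ack_succ_zero, ack_succ_succ]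
    exact ack_mono_right a ((Nat.lt_succ_self a).trans (lt_ack_left (a + 1) 0)).le
  have h3 := ack_le_growth (a + 2) 0
  rw [zero_add] at h3
  omega

theorem half_le_log {n : ℕ} (hn : 2 ≤ n) : 1 / 2 ≤ Real.log n := by
  have h1 := Real.log_two_gt_d9
  have h2 : Real.log 2 ≤ Real.log n :=
    Real.log_le_log (by norm_num) (by exact_mod_cast hn)
  linarith

theorem clog_le {n : ℕ} (hn : 2 ≤ n) {ρ : ℝ} (hρ : 2 ≤ ρ) :
    (Nat.clog 2 n : ℝ) ≤ 4 * ρ * Real.logb ρ n := by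
  have hlog := half_le_log hn
  have hρ0 : 0 < Real.log ρ := Real.log_pos (by linarith)
  have h1 : (Nat.clog 2 n : ℝ) ≤ 4 * Real.log n := by
    have h2 : 2 ^ (Nat.clog 2 n - 1) < n := Nat.pow_pred_clog_lt_self one_lt_two hn
    have hc : 0 < Nat.clog 2 n := Nat.clog_pos one_lt_two hn
    obtain ⟨j, hj⟩ : ∃ j, Nat.clog 2 n = j + 1 := ⟨Nat.clog 2 n - 1, by omega⟩
    rw [hj, Nat.add_sub_cancel] at h2
    have h3 : Real.log ((2 : ℝ) ^ j) ≤ Real.log n :=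
      Real.log_le_log (by positivity) (by exact_mod_cast h2.le)
    rw [Real.log_pow] at h3
    have h4 := Real.log_two_gt_d9
    have h5 : (j : ℝ) * (1 / 2) ≤ j * Real.log 2 :=
      mul_le_mul_of_nonneg_left (by linarith) (Nat.cast_nonneg j)
    rw [hj]
    push_cast
    linarith
  have h2 : Real.log n ≤ ρ * Real.logb ρ n := by
    rw [Real.logb, mul_div_assoc', le_div_iff₀ hρ0, mul_comm ρ]
    exact mul_le_mul_of_nonneg_left (Real.log_le_self (by linarith)) (by linarith)
  linarith

/-- The branching parameter for a given `ρ`. -/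
theorem exists_branching {n : ℕ} (hn : 2 ≤ n) {ρ : ℝ} (hρ : 2 ≤ ρ) :
    ∃ b T : ℕ, 2 ≤ b ∧ (b : ℝ) ≤ ρ ∧ n < b ^ T ∧ (T : ℝ) ≤ 3 * Real.logb ρ n + 2 ∧
      (b * T : ℝ) ≤ 6 * ρ * Real.logb ρ n := by
  have hlog := half_le_log hn
  have hρ0 : 0 < Real.log ρ := Real.log_pos (by linarith)
  have hL : 0 < Real.logb ρ n := div_pos (by linarith) hρ0
  rcases le_or_gt ρ n with h | h
  · have hb : 2 ≤ ⌊ρ⌋₊ := Nat.le_floor (by exact_mod_cast hρ)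
    have hbR : (2 : ℝ) ≤ ⌊ρ⌋₊ := by exact_mod_cast hb
    have hbρ : (⌊ρ⌋₊ : ℝ) ≤ ρ := Nat.floor_le (by linarith)
    have hL1 : 1 ≤ Real.logb ρ n := (one_le_div hρ0).2 (Real.log_le_log (by linarith) h)
    have h1 : Real.log ρ ≤ 2 * Real.log ⌊ρ⌋₊ := by
      have h2 : ρ ≤ (⌊ρ⌋₊ : ℝ) ^ 2 := by nlinarith [Nat.lt_floor_add_one ρ]
      have h3 := Real.log_le_log (by linarith) h2
      rw [Real.log_pow] at h3
      exact_mod_cast h3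
    have h2 : (Nat.log ⌊ρ⌋₊ n : ℝ) ≤ 2 * Real.logb ρ n := by
      have h3 : ⌊ρ⌋₊ ^ Nat.log ⌊ρ⌋₊ n ≤ n := Nat.pow_log_le_self _ (by omega)
      have h4 : Real.log ((⌊ρ⌋₊ : ℝ) ^ Nat.log ⌊ρ⌋₊ n) ≤ Real.log n :=
        Real.log_le_log (by positivity) (by exact_mod_cast h3)
      rw [Real.log_pow] at h4
      rw [Real.logb, mul_div_assoc', le_div_iff₀ hρ0]
      have h5 := mul_le_mul_of_nonneg_left h1 (Nat.cast_nonneg (α := ℝ) (Nat.log ⌊ρ⌋₊ n))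
      linarith
    have hT : ((Nat.log ⌊ρ⌋₊ n + 1 : ℕ) : ℝ) ≤ 3 * Real.logb ρ n := by
      push_cast
      linarith
    refine ⟨⌊ρ⌋₊, Nat.log ⌊ρ⌋₊ n + 1, hb, hbρ, Nat.lt_pow_succ_log_self (by omega) n,
      by linarith, ?_⟩
    have h3 := mul_le_mul hbρ hT (Nat.cast_nonneg _) (by linarith : 0 ≤ ρ)
    have h4 : 0 < ρ * Real.logb ρ n := by positivity
    linarith
  · have hn0 : (0 : ℝ) < n := by exact_mod_cast (by omega : 0 < n)
    refine ⟨n, 2, hn, h.le, by nlinarith, by push_cast; linarith, ?_⟩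
    have h1 := Real.log_le_sub_one_of_pos (by positivity : 0 < ρ / n)
    rw [Real.log_div (by linarith) hn0.ne'] at h1
    have h2 : n * Real.log ρ ≤ n * Real.log n + ρ := by
      have h3 := mul_le_mul_of_nonneg_left h1 hn0.le
      rw [mul_sub, mul_sub, mul_div_cancel₀ _ hn0.ne'] at h3
      linarith
    have h3 : n * Real.log n ≤ ρ * Real.log n := mul_le_mul_of_nonneg_right h.le (by linarith)
    have h4 : ρ * (1 / 2) ≤ ρ * Real.log n := mul_le_mul_of_nonneg_left hlog (by linarith)
    rw [Real.logb, mul_div_assoc', le_div_iff₀ hρ0]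
    push_cast
    linarith

/-- **Optimal spanners for doubling metrics.** For every `d ≥ 1` and `ε > 0` there is a
constant `C = C(d, ε) > 0` such that every finite metric space with `n ≥ 2` points and
doubling dimension at most `d` admits, for every `ρ ≥ 2`, a `(1+ε)`-spanner with at most
`C·n` edges, degree at most `C·ρ`, hop-diameter at most `C·(log_ρ n + α(ρ))`, and
lightness at most `C·ρ·log_ρ n`. -/
theorem optimal_spanners_doubling (d : ℕ) (hd : 1 ≤ d) (ε : ℝ) (hε : 0 < ε) :
    ∃ C : ℝ, 0 < C ∧
      ∀ (P : Type) [MetricSpace P] [Fintype P],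
        2 ≤ Fintype.card P → DoublingDimLE P d →
        ∀ ρ : ℝ, 2 ≤ ρ →
        ∃ H : Finset (Sym2 P),
          IsGraphOn H ∧
          IsSpanner H (1 + ε) ∧
          (H.card : ℝ) ≤ C * Fintype.card P ∧
          (∀ p, (degree H p : ℝ) ≤ C * ρ) ∧
          (∀ p q, ∃ k : ℕ,
            (k : ℝ) ≤ C * (Real.logb ρ (Fintype.card P) + invAck ρ) ∧
            IsSpannerPath H (1 + ε) p q k) ∧
          totalWeight H ≤ C * ρ * Real.logb ρ (Fintype.card P) * mstWeight P := by

  obtain ⟨C, hC, hspan⟩ := exists_spanner d hε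
  refine ⟨10 * C + 47, by linarith, fun P _ _ hcard hdim ρ hρ => ?_⟩
  obtain ⟨b, T, hb, hbρ, hT, hTL, hbT⟩ := exists_branching hcard hρ
  obtain ⟨H, hH, hHcard, hHdeg, hHw, hHpath⟩ := hspan P hcard hdim b T (invAck ρ + 2)
    (Nat.clog 2 (Fintype.card P)) hb hT (two_mul_le_growth hbρ) (Nat.le_pow_clog one_lt_two _)
  have : Nonempty P := Fintype.card_pos_iff.1 (by omega)
  have hmst : 0 ≤ mstWeight P := le_mstWeight fun W _ =>
    Finset.sum_nonneg fun e _ => edgeWeight_nonneg e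
  have hL : 0 ≤ Real.logb ρ (Fintype.card P) :=
    Real.logb_nonneg (by linarith) (by exact_mod_cast (by omega : 1 ≤ Fintype.card P))
  refine ⟨H, hH, fun p q => ?_, ?_, fun p => ?_, fun p q => ?_, ?_⟩
  · obtain ⟨k, -, hk⟩ := hHpath p q
    exact ⟨k, hk⟩
  · exact hHcard.trans (mul_le_mul_of_nonneg_right (by linarith) (Nat.cast_nonneg _))
  · exact (hHdeg p).trans (mul_le_mul (by linarith) hbρ (Nat.cast_nonneg _) (by linarith))
  · obtain ⟨k, hk, hpath⟩ := hHpath p q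
    refine ⟨k, ?_, hpath⟩
    have hk' : (k : ℝ) ≤ 2 * (7 * T + 3 * (invAck ρ + 2)) + 1 := by exact_mod_cast hk
    have ha : (1 : ℝ) ≤ invAck ρ := by exact_mod_cast (invAck_spec ρ).1
    have h1 : 0 ≤ C * (Real.logb ρ (Fintype.card P) + invAck ρ) := by positivity
    linarith
  · refine hHw.trans (mul_le_mul_of_nonneg_right ?_ hmst)
    have h1 := clog_le hcard hρ
    have h2 : C * (Nat.clog 2 (Fintype.card P) + b * T) ≤
        C * (10 * ρ * Real.logb ρ (Fintype.card P)) :=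
      mul_le_mul_of_nonneg_left (by linarith) hC.le
    have h3 : 0 ≤ ρ * Real.logb ρ (Fintype.card P) := mul_nonneg (by linarith) hL
    linarith

end Stmt1
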